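/- arXiv:2012.09399 — 7 statements merged into one kernel-verified Lean document; each statement's English description precedes it below -/
import Mathlib

section
/- Let q = 2^m and let C be an extended cyclic code over F = 𝔽_q with parameters [q+2, 3, q]. Then C is obtained from a regular hyperoval: there exist a generator γ of the cyclic group S = {u ∈ 𝔽_{q²} : u^{q+1} = 1} (so γ has multiplicative order q+1) and an F-basis {1, ξ} of K = 𝔽_{q²} such that, writing γ^i = x_i + y_i·ξ with x_i, y_i ∈ F for 0 ≤ i ≤ q, the code C equals the row space of the 3×(q+2) matrix whose first q+1 columns are (x_i, y_i, 1) for i = 0, …, q and whose last column is (0, 0, 1). In particular, the q+2 columns of this generator matrix, viewed as points of PG(2, q), are pairwise distinct and correspond to the affine point set S ∪ {0} ⊆ K, a regular hyperoval. -/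
/-- A linear code `C ⊆ F^n` is cyclic if the cyclic shift
`(c₀, …, c_{n−1}) ↦ (c_{n−1}, c₀, …, c_{n−2})` maps `C` into itself. -/
def IsCyclicCode {F : Type*} [Field F] {n : ℕ} (C : Submodule F (Fin n → F)) : Prop :=
  ∀ c ∈ C, (fun i : Fin n => c ⟨((i : ℕ) + n - 1) % n, Nat.mod_lt _ i.pos⟩) ∈ C

/-- The linear map sending a word to the word extended by the sum of its coordinates. -/
def extendLM (F : Type*) [Field F] (n : ℕ) : (Fin n → F) →ₗ[F] (Fin (n + 1) → F) where
  toFun c := Fin.snoc c (∑ i, c i)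
  map_add' c d := by
    funext i
    refine Fin.lastCases ?_ (fun j => ?_) i
    · simp [Finset.sum_add_distrib]
    · simp
  map_smul' a c := by
    funext i
    refine Fin.lastCases ?_ (fun j => ?_) i
    · simp [Finset.mul_sum]
    · simp

/-- The extended code of a code of length `n`. -/
def extendCode {F : Type*} [Field F] {n : ℕ} (C : Submodule F (Fin n → F)) :
    Submodule F (Fin (n + 1) → F) :=
  C.map (extendLM F n)

section UnitCircle

variable {F K : Type*} [Field F] [Field K] [Algebra F K] {q : ℕ}

/-- The discrete Fourier coefficient `w ↦ ∑ wᵢ uⁱ` of a word at an element of an extension field. -/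
def wordFourierCoeff (F : Type*) {K : Type*} [Field F] [Field K] [Algebra F K] (q : ℕ) (u : K) :
    (Fin (q + 1) → F) →ₗ[F] K where
  toFun w := ∑ i, w i • u ^ (i : ℕ)
  map_add' v w := by simp [add_smul, Finset.sum_add_distrib]
  map_smul' a w := by simp [mul_smul, Finset.smul_sum]

theorem wordFourierCoeff_shift {u : K} (hu : u ^ (q + 1) = 1) (w : Fin (q + 1) → F) :
    wordFourierCoeff F q u
        (fun i => w ⟨((i : ℕ) + (q + 1) - 1) % (q + 1), Nat.mod_lt _ i.pos⟩) =
      u * wordFourierCoeff F q u w := by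
  have hpow : ∀ j : Fin (q + 1), u ^ ((j + 1 : Fin (q + 1)) : ℕ) = u * u ^ (j : ℕ) := by
    intro j
    rw [Fin.val_add, ← pow_eq_pow_mod _ hu, pow_add, Fin.val_one', ← pow_eq_pow_mod _ hu, pow_one,
      mul_comm]
  have hidx : ∀ j : Fin (q + 1),
      (⟨(((j + 1 : Fin (q + 1)) : ℕ) + (q + 1) - 1) % (q + 1), Nat.mod_lt _ j.pos⟩ :
        Fin (q + 1)) = j := by
    intro j
    ext
    rw [Fin.val_add_one]
    have := j.isLt
    split_ifs with h
    · subst h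
      simp
    · simp only [Nat.add_right_comm _ 1, Nat.add_sub_cancel]
      rw [Nat.add_mod_right, Nat.mod_eq_of_lt this]
  simp only [wordFourierCoeff, LinearMap.coe_mk, AddHom.coe_mk]
  rw [← Equiv.sum_comp (Equiv.addRight (1 : Fin (q + 1))), Finset.mul_sum]
  refine Finset.sum_congr rfl fun j _ => ?_
  simp only [Equiv.coe_addRight, hidx, hpow, mul_smul_comm]

/-- A cyclic code has at most `dim C` nonzero Fourier coefficients. -/
theorem card_wordFourierCoeff_ne_zero_le {C : Submodule F (Fin (q + 1) → F)} (hC : IsCyclicCode C)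
    (s : Finset K) (hs : ∀ u ∈ s, u ^ (q + 1) = 1)
    (hne : ∀ u ∈ s, ∃ w ∈ C, wordFourierCoeff F q u w ≠ 0) :
    s.card ≤ Module.finrank F C := by
  let T : C →ₗ[F] C :=
    { toFun := fun w => ⟨_, hC w w.2⟩
      map_add' := fun _ _ => rfl
      map_smul' := fun _ _ => rfl }
  let f : Module.End K (C →ₗ[F] K) :=
    { toFun := fun g => g ∘ₗ T
      map_add' := fun _ _ => rfl
      map_smul' := fun _ _ => rfl }
  have hli := Module.End.eigenvectors_linearIndependent f (s : Set K)
    (fun u => (wordFourierCoeff F q (u : K)).comp C.subtype) (fun u => by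
      refine ⟨Module.End.mem_eigenspace_iff.2 ?_, ?_⟩
      · ext w
        exact wordFourierCoeff_shift (hs u u.2) (w : Fin (q + 1) → F)
      · obtain ⟨w, hw, hw0⟩ := hne u u.2
        intro h
        exact hw0 (LinearMap.congr_fun h ⟨w, hw⟩))
  have := hli.fintype_card_le_finrank
  rw [Module.finrank_linearMap_self] at this
  simpa using this

/-- The order of `γ` is forced by the minimum distance: a repeated column would give a nonzero
word with three zeros. -/
theorem orderOf_eq_of_le_hammingNorm [DecidableEq F] {γ : K} (hq : 2 ≤ q)
    (hγ : γ ^ (q + 1) = 1) (hγ1 : γ ≠ 1)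
    (hbasis : ∀ z : K, ∃! p : F × F, z = algebraMap F K p.1 + p.2 • γ)
    {x y : Fin (q + 1) → F} (hxy : ∀ i, algebraMap F K (x i) + y i • γ = γ ^ (i : ℕ))
    (hdist : ∀ c ∈ Submodule.span F
      {(Fin.snoc x 0 : Fin (q + 2) → F), Fin.snoc y 0, fun _ => 1}, c ≠ 0 → q ≤ hammingNorm c) :
    orderOf γ = q + 1 := by
  by_contra hne
  have hle : orderOf γ ≤ q + 1 := orderOf_le_of_pow_eq_one (Nat.succ_pos q) hγ
  have hpos : 0 < orderOf γ := (isOfFinOrder_iff_pow_eq_one.2 ⟨_, Nat.succ_pos q, hγ⟩).orderOf_pos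
  have hone : orderOf γ ≠ 1 := fun h => hγ1 (orderOf_eq_one_iff.1 h)
  let v : Fin (q + 2) → F := (fun _ => 1) - Fin.snoc x 0 - Fin.snoc y 0
  have hv : v ∈ Submodule.span F
      {(Fin.snoc x 0 : Fin (q + 2) → F), Fin.snoc y 0, fun _ => 1} :=
    Submodule.sub_mem _ (Submodule.sub_mem _ (Submodule.subset_span (by simp))
      (Submodule.subset_span (by simp))) (Submodule.subset_span (by simp))
  have hv0 : v ≠ 0 := fun h => by simpa [v] using congrFun h (Fin.last (q + 1))
  have hzero : ∀ (i : Fin (q + 1)) (a b : F),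
      γ ^ (i : ℕ) = algebraMap F K a + b • γ → a + b = 1 → v i.castSucc = 0 := by
    intro i a b h hab
    have := (hbasis _).unique (y₁ := (x i, y i)) (y₂ := (a, b)) (hxy i).symm h
    obtain ⟨hx, hy⟩ := Prod.mk.inj this
    simp only [v, Pi.sub_apply, Fin.snoc_castSucc, hx, hy, ← hab]
    ring
  let i₀ : Fin (q + 1) := ⟨0, by omega⟩
  let i₁ : Fin (q + 1) := ⟨1, by omega⟩
  let i₂ : Fin (q + 1) := ⟨orderOf γ, by omega⟩
  have h₀ : v i₀.castSucc = 0 := hzero i₀ 1 0 (by simp [i₀]) (by simp)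
  have h₁ : v i₁.castSucc = 0 := hzero i₁ 0 1 (by simp [i₁]) (by simp)
  have h₂ : v i₂.castSucc = 0 := hzero i₂ 1 0 (by simp [i₂, pow_orderOf_eq_one]) (by simp)
  have hsub : Finset.univ.filter (fun i => v i ≠ 0) ⊆
      ({i₀.castSucc, i₁.castSucc, i₂.castSucc} : Finset (Fin (q + 2)))ᶜ := by
    intro i hi
    simp only [Finset.mem_filter, Finset.mem_univ, true_and] at hi
    simp only [Finset.mem_compl, Finset.mem_insert, Finset.mem_singleton]
    rintro (rfl | rfl | rfl)
    · exact hi h₀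
    · exact hi h₁
    · exact hi h₂
  have hcard := Finset.card_le_card hsub
  have hthree : ({i₀.castSucc, i₁.castSucc, i₂.castSucc} : Finset (Fin (q + 2))).card = 3 := by
    refine Finset.card_eq_three.2 ⟨_, _, _, ?_, ?_, ?_, rfl⟩ <;>
      simp only [i₀, i₁, i₂, ne_eq, Fin.ext_iff, Fin.val_castSucc] <;> omega
  rw [Finset.card_compl, hthree, Fintype.card_fin] at hcard
  have hnorm : q ≤ (Finset.univ.filter (fun i => v i ≠ 0)).card := hdist v hv hv0
  omega

theorem sum_coordinates_pow_eq_zero {γ : K} (hγ : γ ^ (q + 1) = 1) (hγ1 : γ ≠ 1)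
    (hbasis : ∀ z : K, ∃! p : F × F, z = algebraMap F K p.1 + p.2 • γ)
    {x y : Fin (q + 1) → F} (hxy : ∀ i, algebraMap F K (x i) + y i • γ = γ ^ (i : ℕ)) :
    ∑ i, x i = 0 ∧ ∑ i, y i = 0 := by
  have hgeom : ∑ i : Fin (q + 1), γ ^ (i : ℕ) = 0 := by
    rw [Fin.sum_univ_eq_sum_range (fun i => γ ^ i)]
    have := mul_geom_sum γ (q + 1)
    rw [hγ, sub_self] at this
    exact (mul_eq_zero.1 this).resolve_left (sub_ne_zero.2 hγ1)
  have := (hbasis 0).unique (y₁ := (∑ i, x i, ∑ i, y i)) (y₂ := (0, 0))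
    (by simp only [map_sum, Finset.sum_smul, ← Finset.sum_add_distrib, hxy, hgeom]) (by simp)
  exact Prod.mk.inj this

variable [Fintype F]

theorem mem_range_algebraMap_of_pow_card_eq (hF : Fintype.card F = q) {z : K} (hz : z ^ q = z) :
    ∃ c : F, algebraMap F K c = z := by
  classical
  by_contra! h
  have hq : 1 < q := hF ▸ Fintype.one_lt_card
  have hne := FiniteField.X_pow_card_sub_X_ne_zero K hq
  have hsub : (insert z (Finset.univ.image (algebraMap F K))).val ⊆
      (Polynomial.X ^ q - Polynomial.X : Polynomial K).roots := by
    intro a ha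
    rw [Finset.mem_val, Finset.mem_insert, Finset.mem_image] at ha
    rw [Polynomial.mem_roots hne, Polynomial.IsRoot.def]
    rcases ha with rfl | ⟨c, -, rfl⟩
    · simp [hz]
    · rw [Polynomial.eval_sub, Polynomial.eval_pow, Polynomial.eval_X, ← map_pow, ← hF,
        FiniteField.pow_card, sub_self]
  have hle := Polynomial.card_le_degree_of_subset_roots hsub
  rw [FiniteField.X_pow_card_sub_X_natDegree_eq K hq, Finset.card_insert_of_notMem,
    Finset.card_image_of_injective _ (algebraMap F K).injective, Finset.card_univ, hF] at hle
  · omega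
  · simpa using h

theorem exists_isPrimitiveRoot_card_add_one [Fintype K] (hK : Fintype.card K = q ^ 2)
    (hq : 2 ≤ q) : ∃ ω : K, IsPrimitiveRoot ω (q + 1) := by
  obtain ⟨g, hg⟩ := IsCyclic.exists_ofOrder_eq_natCard (α := Kˣ)
  rw [Nat.card_units, Nat.card_eq_fintype_card, hK] at hg
  have hprim : IsPrimitiveRoot (g : K) (q ^ 2 - 1) :=
    hg ▸ orderOf_units (y := g) ▸ IsPrimitiveRoot.orderOf (g : K)
  refine ⟨(g : K) ^ (q - 1), hprim.pow ?_ ?_⟩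
  · have : 2 ^ 2 ≤ q ^ 2 := Nat.pow_le_pow_left hq 2
    omega
  · obtain ⟨k, rfl⟩ : ∃ k, q = k + 1 := ⟨q - 1, by omega⟩
    simp only [Nat.add_sub_cancel]
    have : (k + 1) ^ 2 = k * (k + 1 + 1) + 1 := by ring
    omega

theorem sum_pow_mul_inv_pow {ω : K} (hω : IsPrimitiveRoot ω (q + 1)) {S : Finset K}
    (hS : ∀ u, u ∈ S ↔ u ^ (q + 1) = 1) (i j : Fin (q + 1)) (hij : i ≠ j) :
    ∑ u ∈ S, u ^ (j : ℕ) * u⁻¹ ^ (i : ℕ) = 0 := by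
  have hω0 : ω ≠ 0 := hω.ne_zero (Nat.succ_ne_zero q)
  have hsum : ∑ u ∈ S, u ^ (j : ℕ) * u⁻¹ ^ (i : ℕ) =
      ∑ u ∈ S, (ω * u) ^ (j : ℕ) * (ω * u)⁻¹ ^ (i : ℕ) := by
    refine (Finset.sum_bij (fun u _ => ω * u) ?_ ?_ ?_ ?_).symm
    · intro u hu
      rw [hS] at hu ⊢
      rw [mul_pow, hu, hω.pow_eq_one, one_mul]
    · intro u _ v _ h
      exact mul_left_cancel₀ hω0 h
    · intro u hu
      rw [hS] at hu
      refine ⟨ω⁻¹ * u, ?_, mul_inv_cancel_left₀ hω0 u⟩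
      rw [hS, mul_pow, hu, inv_pow, hω.pow_eq_one, inv_one, one_mul]
    · intros; rfl
  have hfac : ∑ u ∈ S, (ω * u) ^ (j : ℕ) * (ω * u)⁻¹ ^ (i : ℕ) =
      (ω ^ (j : ℕ) * ω⁻¹ ^ (i : ℕ)) * ∑ u ∈ S, u ^ (j : ℕ) * u⁻¹ ^ (i : ℕ) := by
    rw [Finset.mul_sum]
    refine Finset.sum_congr rfl fun u _ => ?_
    rw [mul_inv, mul_pow, mul_pow]
    ring
  rw [hfac] at hsum
  by_contra h0
  have h1 : ω ^ (j : ℕ) * ω⁻¹ ^ (i : ℕ) = 1 := (mul_eq_right₀ h0).1 hsum.symm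
  rw [inv_pow, mul_inv_eq_one₀ (pow_ne_zero _ hω0)] at h1
  exact hij (Fin.ext (hω.pow_inj j.isLt i.isLt h1).symm)

theorem sum_wordFourierCoeff_mul_inv_pow (hF : Fintype.card F = q) {ω : K}
    (hω : IsPrimitiveRoot ω (q + 1)) {S : Finset K} (hS : ∀ u, u ∈ S ↔ u ^ (q + 1) = 1)
    (w : Fin (q + 1) → F) (i : Fin (q + 1)) :
    ∑ u ∈ S, wordFourierCoeff F q u w * u⁻¹ ^ (i : ℕ) = algebraMap F K (w i) := by
  have hcard : (S.card : K) = 1 := by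
    have hSn : S = Polynomial.nthRootsFinset (q + 1) (1 : K) := by
      ext u
      rw [hS, Polynomial.mem_nthRootsFinset (Nat.succ_pos q)]
    have hq0 : (q : K) = 0 := by
      have := congrArg (algebraMap F K) (FiniteField.cast_card_eq_zero F)
      simpa [hF] using this
    rw [hSn, hω.card_nthRootsFinset, Nat.cast_add, hq0, Nat.cast_one, zero_add]
  simp only [wordFourierCoeff, LinearMap.coe_mk, AddHom.coe_mk, Finset.sum_mul, smul_mul_assoc]
  rw [Finset.sum_comm]
  simp only [← Finset.smul_sum]
  rw [Finset.sum_eq_single i]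
  · rw [Finset.sum_congr rfl (g := fun _ => (1 : K))]
    · rw [Finset.sum_const, nsmul_eq_mul, hcard, mul_one, Algebra.smul_def, mul_one]
    · intro u hu
      have hu0 : u ≠ 0 := by
        rintro rfl
        simp [hS] at hu
      rw [← mul_pow, mul_inv_cancel₀ hu0, one_pow]
  · intro j _ hji
    rw [sum_pow_mul_inv_pow hω hS i j hji.symm, smul_zero]
  · simp

theorem wordFourierCoeff_pow_card (hF : Fintype.card F = q) {u : K} (hu : u ^ (q + 1) = 1)
    (w : Fin (q + 1) → F) : wordFourierCoeff F q u w ^ q = wordFourierCoeff F q u⁻¹ w := by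
  have hinv : u ^ q = u⁻¹ := eq_inv_of_mul_eq_one_left (by rw [← pow_succ, hu])
  subst hF
  have := map_sum (FiniteField.frobeniusAlgHom F K) (fun i => w i • u ^ (i : ℕ)) Finset.univ
  simp only [FiniteField.coe_frobeniusAlgHom] at this
  simp only [wordFourierCoeff, LinearMap.coe_mk, AddHom.coe_mk]
  rw [this]
  refine Finset.sum_congr rfl fun i _ => ?_
  rw [smul_pow, FiniteField.pow_card, ← hinv, ← pow_mul, ← pow_mul, mul_comm]

theorem ne_inv_of_pow_eq_one [CharP K 2] {u : K} (hu : u ^ (q + 1) = 1) (hu1 : u ≠ 1) :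
    u ≠ u⁻¹ := by
  intro h
  have hu0 : u ≠ 0 := by
    rintro rfl
    simp at hu
  have h2 : (u + 1) ^ 2 = 0 := by
    rw [CharTwo.add_sq, sq, one_pow]
    nth_rewrite 2 [h]
    rw [mul_inv_cancel₀ hu0, CharTwo.add_self_eq_zero]
  exact hu1 (CharTwo.add_eq_zero.1 (pow_eq_zero_iff two_ne_zero |>.1 h2))

theorem exists_wordFourierCoeff_eq_zero_of_finrank_le_three [CharP K 2]
    (hF : Fintype.card F = q)
    {C : Submodule F (Fin (q + 1) → F)} (hC : IsCyclicCode C) (hdim : Module.finrank F C ≤ 3)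
    {ω : K} (hω : IsPrimitiveRoot ω (q + 1)) (hω1 : ω ≠ 1) :
    ∃ γ : K, γ ^ (q + 1) = 1 ∧ γ ≠ 1 ∧
      ∀ u : K, u ^ (q + 1) = 1 → u ≠ 1 → u ≠ γ → u ≠ γ⁻¹ →
        ∀ w ∈ C, wordFourierCoeff F q u w = 0 := by
  classical
  by_cases hex : ∃ γ : K, γ ^ (q + 1) = 1 ∧ γ ≠ 1 ∧ ∃ w ∈ C, wordFourierCoeff F q γ w ≠ 0
  · obtain ⟨γ, hγ, hγ1, hγw⟩ := hex
    refine ⟨γ, hγ, hγ1, fun u hu hu1 huγ huγ' w hw => ?_⟩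
    by_contra hne
    have hconj : ∀ v : K, v ^ (q + 1) = 1 → (∃ w ∈ C, wordFourierCoeff F q v w ≠ 0) →
        ∃ w ∈ C, wordFourierCoeff F q v⁻¹ w ≠ 0 := by
      rintro v hv ⟨w, hw, h⟩
      exact ⟨w, hw, by rw [← wordFourierCoeff_pow_card hF hv]; exact pow_ne_zero _ h⟩
    have hcard := card_wordFourierCoeff_ne_zero_le hC ({u, u⁻¹, γ, γ⁻¹} : Finset K)
      (by simp [hu, hγ])
      (by
        simp only [Finset.mem_insert, Finset.mem_singleton, forall_eq_or_imp, forall_eq]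
        exact ⟨⟨w, hw, hne⟩, hconj u hu ⟨w, hw, hne⟩, hγw, hconj γ hγ hγw⟩)
    have hfour : ({u, u⁻¹, γ, γ⁻¹} : Finset K).card = 4 := by
      rw [Finset.card_insert_of_notMem, Finset.card_insert_of_notMem,
        Finset.card_insert_of_notMem, Finset.card_singleton]
      · simpa using ne_inv_of_pow_eq_one hγ hγ1
      · simp only [Finset.mem_insert, Finset.mem_singleton, not_or]
        exact ⟨fun h => huγ' (inv_eq_iff_eq_inv.1 h), fun h => huγ (inv_injective h)⟩
      · simp only [Finset.mem_insert, Finset.mem_singleton, not_or]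
        exact ⟨ne_inv_of_pow_eq_one hu hu1, huγ, huγ'⟩
    omega
  · push Not at hex
    exact ⟨ω, hω.pow_eq_one, hω1, fun u hu hu1 _ _ => hex u hu hu1⟩

theorem algebraMap_ne_of_pow_card_add_one [CharP K 2] (hF : Fintype.card F = q) {γ : K}
    (hγ : γ ^ (q + 1) = 1) (hγ1 : γ ≠ 1) (c : F) : algebraMap F K c ≠ γ := by
  rintro rfl
  have h : (algebraMap F K c) ^ q = algebraMap F K c := by
    rw [← map_pow, ← hF, FiniteField.pow_card]
  have h2 : (algebraMap F K c + 1) ^ 2 = 0 := by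
    rw [pow_succ, h] at hγ
    rw [CharTwo.add_sq, sq, hγ, one_pow, CharTwo.add_self_eq_zero]
  exact hγ1 (CharTwo.add_eq_zero.1 (pow_eq_zero_iff two_ne_zero |>.1 h2))

theorem existsUnique_algebraMap_add_smul [Fintype K] (hF : Fintype.card F = q)
    (hK : Fintype.card K = q ^ 2) {γ : K} (hγ : ∀ c : F, algebraMap F K c ≠ γ) (z : K) :
    ∃! p : F × F, z = algebraMap F K p.1 + p.2 • γ := by
  have hinj : Function.Injective fun p : F × F => algebraMap F K p.1 + p.2 • γ := by
    rintro ⟨a, b⟩ ⟨c, d⟩ h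
    simp only [Algebra.smul_def] at h
    have hbd : b = d := by
      by_contra hbd
      have hbd' : algebraMap F K (b - d) ≠ 0 := by
        simpa [sub_eq_zero] using hbd
      refine hγ ((c - a) / (b - d)) ?_
      rw [map_div₀, div_eq_iff hbd', map_sub, map_sub]
      linear_combination -h
    subst hbd
    simpa using h
  have hbij := (Fintype.bijective_iff_injective_and_card _).2
    ⟨hinj, by rw [Fintype.card_prod, hF, hK, sq]⟩
  obtain ⟨p, hp, huniq⟩ := hbij.existsUnique z
  exact ⟨p, hp.symm, fun r hr => huniq r hr.symm⟩

theorem exists_eq_combination_of_wordFourierCoeff [CharP K 2] (hF : Fintype.card F = q)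
    {ω γ : K} (hω : IsPrimitiveRoot ω (q + 1)) (hγ : γ ^ (q + 1) = 1) (hγ1 : γ ≠ 1)
    (hbasis : ∀ z : K, ∃! p : F × F, z = algebraMap F K p.1 + p.2 • γ)
    {x y : Fin (q + 1) → F} (hxy : ∀ i, algebraMap F K (x i) + y i • γ = γ ^ (i : ℕ))
    {w : Fin (q + 1) → F}
    (hw : ∀ u : K, u ^ (q + 1) = 1 → u ≠ 1 → u ≠ γ → u ≠ γ⁻¹ → wordFourierCoeff F q u w = 0) :
    ∃ a b c : F, ∀ i, w i = a + b * x i + c * y i := by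
  classical
  have hinv : γ ^ q = γ⁻¹ := eq_inv_of_mul_eq_one_left (by rw [← pow_succ, hγ])
  have hxy' : ∀ i, algebraMap F K (x i) + y i • γ⁻¹ = γ⁻¹ ^ (i : ℕ) := by
    intro i
    have := congrArg (FiniteField.frobeniusAlgHom F K) (hxy i)
    rw [map_add, map_smul, map_pow, AlgHom.commutes, FiniteField.coe_frobeniusAlgHom] at this
    simpa only [hF, hinv] using this
  let S : Finset K := Polynomial.nthRootsFinset (q + 1) (1 : K)
  have hS : ∀ u, u ∈ S ↔ u ^ (q + 1) = 1 := fun u =>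
    Polynomial.mem_nthRootsFinset (Nat.succ_pos q) _
  have hne : γ ≠ γ⁻¹ := ne_inv_of_pow_eq_one hγ hγ1
  have hsum : ∀ i, algebraMap F K (w i) = wordFourierCoeff F q 1 w +
      wordFourierCoeff F q γ w * γ⁻¹ ^ (i : ℕ) + wordFourierCoeff F q γ⁻¹ w * γ ^ (i : ℕ) := by
    intro i
    rw [← sum_wordFourierCoeff_mul_inv_pow hF hω hS w i,
      ← Finset.sum_subset (s₁ := {1, γ, γ⁻¹})]
    · rw [Finset.sum_insert, Finset.sum_insert, Finset.sum_singleton]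
      · simp [add_assoc]
      · simpa using hne
      · simp only [Finset.mem_insert, Finset.mem_singleton, not_or]
        exact ⟨hγ1.symm, fun h => hγ1 (inv_eq_one.1 h.symm)⟩
    · intro u hu
      rw [hS]
      simp only [Finset.mem_insert, Finset.mem_singleton] at hu
      rcases hu with rfl | rfl | rfl
      · exact one_pow _
      · exact hγ
      · rw [inv_pow, hγ, inv_one]
    · intro u hu hu'
      simp only [Finset.mem_insert, Finset.mem_singleton, not_or] at hu'
      rw [hw u ((hS u).1 hu) hu'.1 hu'.2.1 hu'.2.2, zero_mul]
  choose p hp hpu using hbasis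
  refine ⟨(p (wordFourierCoeff F q (1 : K) w)).1,
    (p (wordFourierCoeff F q γ w + wordFourierCoeff F q γ⁻¹ w)).1,
    (p (wordFourierCoeff F q γ w * γ⁻¹ + wordFourierCoeff F q γ⁻¹ w * γ)).1, fun i => ?_⟩
  have hi := hsum i
  rw [← hxy, ← hxy'] at hi
  simp only [Algebra.smul_def] at hi hp
  set A := wordFourierCoeff F q (1 : K) w
  set B := wordFourierCoeff F q γ w + wordFourierCoeff F q γ⁻¹ w with hB
  set D := wordFourierCoeff F q γ w * γ⁻¹ + wordFourierCoeff F q γ⁻¹ w * γ with hD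
  have hi' : algebraMap F K (w i) =
      A + algebraMap F K (x i) * B + algebraMap F K (y i) * D := by
    rw [hi, hB, hD]
    ring
  have huniq : ∀ r s : F × F, algebraMap F K r.1 + algebraMap F K r.2 * γ =
      algebraMap F K s.1 + algebraMap F K s.2 * γ → r = s := by
    intro r s h
    simp only [← Algebra.smul_def] at h
    exact (hpu _ r rfl).trans (hpu _ s h).symm
  have := congrArg Prod.fst (huniq (w i, 0)
    ((p A).1 + (p B).1 * x i + (p D).1 * y i, (p A).2 + (p B).2 * x i + (p D).2 * y i) (by
      simp only [map_add, map_mul, map_zero, zero_mul, add_zero]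
      rw [hi']
      conv_lhs => rw [hp A, hp B, hp D]
      ring))
  exact this

theorem ncard_unitCircle_union_zero_inter_line [CharP F 2] [CharP K 2] [Fintype K]
    (hF : Fintype.card F = q) (hK : Fintype.card K = q ^ 2) (a b : K) (hb : b ≠ 0) :
    (({z : K | z ^ (q + 1) = 1} ∪ {0}) ∩ {z : K | ∃ c : F, z = a + c • b}).ncard = 0 ∨
    (({z : K | z ^ (q + 1) = 1} ∪ {0}) ∩ {z : K | ∃ c : F, z = a + c • b}).ncard = 2 := by
  set L : Set K := {z : K | ∃ c : F, z = a + c • b} with hL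
  have hfrob : ∀ c : F, (algebraMap F K c) ^ q = algebraMap F K c := by
    intro c
    rw [← map_pow, ← hF, FiniteField.pow_card]
  have hadd : ∀ u v : K, (u + v) ^ q = u ^ q + v ^ q := by
    intro u v
    have := map_add (FiniteField.frobeniusAlgHom F K) u v
    simpa only [FiniteField.coe_frobeniusAlgHom, hF] using this
  have hqq : ∀ z : K, (z ^ q) ^ q = z := by
    intro z
    rw [← pow_mul, ← sq, ← hK, FiniteField.pow_card]
  have hL' : ∀ z₀ ∈ L, ∀ z, z ∈ L ↔ ∃ c : F, z = z₀ + algebraMap F K c * b := by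
    rintro z₀ ⟨c₀, rfl⟩ z
    simp only [hL, Set.mem_ofPred_eq, Algebra.smul_def]
    constructor
    · rintro ⟨c, rfl⟩
      exact ⟨c - c₀, by rw [map_sub]; ring⟩
    · rintro ⟨c, rfl⟩
      exact ⟨c + c₀, by rw [map_add]; ring⟩
  have hbq : b ^ q ≠ 0 := pow_ne_zero _ hb
  by_cases h0 : (0 : K) ∈ L
  · right
    obtain ⟨n, hn⟩ := mem_range_algebraMap_of_pow_card_eq hF (z := b ^ (q + 1)) (by
      rw [pow_succ, mul_pow, hqq, mul_comm])
    have hn0 : n ≠ 0 := by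
      rintro rfl
      rw [map_zero] at hn
      exact pow_ne_zero _ hb hn.symm
    obtain ⟨c, hc⟩ := FiniteField.isSquare_of_char_two (ringChar.eq F 2) n⁻¹
    have hc0 : c ≠ 0 := by
      rintro rfl
      simp [hn0] at hc
    have hnorm : ∀ d : F, (algebraMap F K d * b) ^ (q + 1) = 1 ↔ d = c := by
      intro d
      rw [mul_pow, ← hn, pow_succ, hfrob, ← map_mul, ← map_mul, ← map_one (algebraMap F K),
        (algebraMap F K).injective.eq_iff, ← eq_mul_inv_iff_mul_eq₀ hn0, one_mul, hc, ← sq, ← sq]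
      exact (CharTwo.sq_injective (R := F)).eq_iff
    have hset : (({z : K | z ^ (q + 1) = 1} ∪ {0}) ∩ L) = {0, algebraMap F K c * b} := by
      ext z
      simp only [Set.mem_inter_iff, Set.mem_union, Set.mem_ofPred_eq, Set.mem_singleton_iff,
        Set.mem_insert_iff, hL' 0 h0, zero_add]
      constructor
      · rintro ⟨hz | hz, d, rfl⟩
        · right
          rw [(hnorm d).1 hz]
        · exact Or.inl hz
      · rintro (rfl | rfl)
        · exact ⟨Or.inr rfl, 0, by simp⟩
        · exact ⟨Or.inl ((hnorm c).2 rfl), c, rfl⟩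
    rw [hset, Set.ncard_pair]
    simpa using ⟨hc0, hb⟩
  · rcases Set.eq_empty_or_nonempty
        (({z : K | z ^ (q + 1) = 1} ∪ {0}) ∩ L) with he | ⟨z₀, hz₀, hz₀L⟩
    · left
      rw [he, Set.ncard_empty]
    right
    have hz₀1 : z₀ ^ (q + 1) = 1 := by
      rcases hz₀ with h | h
      · exact h
      · rw [Set.mem_singleton_iff] at h
        exact absurd (h ▸ hz₀L) h0
    have hb1 : b ^ (q + 1) ≠ 0 := pow_ne_zero _ hb
    obtain ⟨c, hc⟩ := mem_range_algebraMap_of_pow_card_eq hF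
      (z := (z₀ * b ^ q + z₀ ^ q * b) / b ^ (q + 1)) (by
        rw [div_pow, hadd, pow_succ b q, mul_pow, mul_pow, mul_pow, hqq, hqq]
        ring)
    rw [eq_div_iff hb1] at hc
    have hc0 : c ≠ 0 := by
      rintro rfl
      rw [map_zero, zero_mul] at hc
      have hc' := CharTwo.add_eq_zero.1 hc.symm
      obtain ⟨d, hd⟩ := mem_range_algebraMap_of_pow_card_eq hF (z := z₀ / b) (by
        rw [div_pow, div_eq_div_iff hbq hb, hc'])
      rw [eq_div_iff hb] at hd
      refine h0 ((hL' z₀ hz₀L 0).2 ⟨d, ?_⟩)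
      rw [hd, CharTwo.add_self_eq_zero]
    have hnorm : ∀ d : F, (z₀ + algebraMap F K d * b) ^ (q + 1) = 1 ↔ d = 0 ∨ d = c := by
      intro d
      have hexp : (z₀ + algebraMap F K d * b) ^ (q + 1) =
          1 + algebraMap F K d * (algebraMap F K (c + d)) * b ^ (q + 1) := by
        rw [pow_succ, hadd, mul_pow, hfrob, map_add]
        linear_combination hz₀1 - algebraMap F K d * hc
      rw [hexp, add_eq_left, mul_eq_zero, or_iff_left hb1, mul_eq_zero, map_eq_zero, map_eq_zero,
        CharTwo.add_eq_zero, eq_comm (a := c)]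
    have hset : (({z : K | z ^ (q + 1) = 1} ∪ {0}) ∩ L) = {z₀, z₀ + algebraMap F K c * b} := by
      ext z
      simp only [Set.mem_inter_iff, Set.mem_union, Set.mem_ofPred_eq, Set.mem_singleton_iff,
        Set.mem_insert_iff]
      constructor
      · rintro ⟨hz | rfl, hzL⟩
        · obtain ⟨d, rfl⟩ := (hL' z₀ hz₀L z).1 hzL
          rcases (hnorm d).1 hz with rfl | rfl
          · left
            simp
          · exact Or.inr rfl
        · exact absurd hzL h0
      · rintro (rfl | rfl)
        · exact ⟨Or.inl hz₀1, hz₀L⟩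
        · exact ⟨Or.inl ((hnorm c).2 (Or.inr rfl)), (hL' z₀ hz₀L _).2 ⟨c, rfl⟩⟩
    rw [hset, Set.ncard_pair]
    simpa using ⟨hc0, hb⟩

end UnitCircle

/-- **Theorem (extended cyclic `[q+2, 3, q]` codes are regular-hyperoval codes).**
Let `q = 2^m` and let `C` be an extended cyclic code over `F = 𝔽_q` with parameters
`[q+2, 3, q]`.  Then there are a generator `γ` of the unit circle
`S = {u ∈ K = 𝔽_{q²} : u^(q+1) = 1}` (i.e. `γ` has order `q+1`) and an `F`-basis `{1, ξ}`
of `K` such that, writing `γ^i = x_i + y_i·ξ`, the code `C` is the row space of the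
`3 × (q+2)` matrix with columns `(x_i, y_i, 1)`, `0 ≤ i ≤ q`, and `(0, 0, 1)`.  The
columns are pairwise distinct points of `PG(2,q)` and correspond to the affine point set
`S ∪ {0} ⊆ K`, a regular hyperoval (a set of `q+2` points meeting every affine line in
`0` or `2` points). -/
theorem extended_cyclic_code_gives_regular_hyperoval
    (m q : ℕ) (hm : 1 ≤ m) (hq : q = 2 ^ m)
    (F K : Type*) [Field F] [Fintype F] [DecidableEq F] [Field K] [Fintype K] [Algebra F K]
    (hF : Fintype.card F = q) (hK : Fintype.card K = q ^ 2)
    (C : Submodule F (Fin (q + 2) → F))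
    (hext : ∃ C' : Submodule F (Fin (q + 1) → F), IsCyclicCode C' ∧ C = extendCode C')
    (hdim : Module.finrank F ↥C = 3)
    (hdist : (∀ c ∈ C, c ≠ 0 → q ≤ hammingNorm c) ∧ ∃ c ∈ C, c ≠ 0 ∧ hammingNorm c = q) :
    ∃ (γ ξ : K) (x y : Fin (q + 1) → F),
      orderOf γ = q + 1 ∧
      (∀ z : K, ∃! p : F × F, z = algebraMap F K p.1 + p.2 • ξ) ∧
      (∀ i : Fin (q + 1), algebraMap F K (x i) + y i • ξ = γ ^ (i : ℕ)) ∧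
      C = Submodule.span F {Fin.snoc x 0, Fin.snoc y 0, fun _ => 1} ∧
      Function.Injective (fun j : Fin (q + 2) => (Fin.snoc x 0 j, Fin.snoc y 0 j)) ∧
      (Set.range fun i : Fin (q + 1) => γ ^ (i : ℕ)) ∪ {0} = {z : K | z ^ (q + 1) = 1} ∪ {0} ∧
      Set.ncard ({z : K | z ^ (q + 1) = 1} ∪ {0}) = q + 2 ∧
      (∀ a b : K, b ≠ 0 →
        (({z : K | z ^ (q + 1) = 1} ∪ {0}) ∩ {z : K | ∃ c : F, z = a + c • b}).ncard = 0 ∨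
        (({z : K | z ^ (q + 1) = 1} ∪ {0}) ∩ {z : K | ∃ c : F, z = a + c • b}).ncard = 2) := by
  classical
  have hq2 : 2 ≤ q := by
    rw [hq]
    exact (Nat.pow_le_pow_right two_pos hm : 2 ^ 1 ≤ 2 ^ m)
  have : CharP F 2 := charP_of_card_eq_prime_pow (hF.trans hq)
  have : CharP K 2 := charP_of_injective_algebraMap (algebraMap F K).injective 2
  obtain ⟨C', hcyc, rfl⟩ := hext
  have hinj : Function.Injective (extendLM F (q + 1)) := by
    intro v w h
    funext i
    simpa [extendLM] using congrFun h i.castSucc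
  have hdim' : Module.finrank F C' = 3 := by
    rw [← hdim]
    exact (Submodule.equivMapOfInjective _ hinj C').finrank_eq
  obtain ⟨ω, hω⟩ := exists_isPrimitiveRoot_card_add_one hK hq2
  obtain ⟨γ, hγ, hγ1, hcoeff⟩ := exists_wordFourierCoeff_eq_zero_of_finrank_le_three hF hcyc
    hdim'.le hω (hω.ne_one (by omega))
  have hbasis := existsUnique_algebraMap_add_smul hF hK
    (algebraMap_ne_of_pow_card_add_one hF hγ hγ1)
  choose p hp using fun i : Fin (q + 1) => (hbasis (γ ^ (i : ℕ))).exists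
  let x : Fin (q + 1) → F := fun i => (p i).1
  let y : Fin (q + 1) → F := fun i => (p i).2
  have hxy : ∀ i, algebraMap F K (x i) + y i • γ = γ ^ (i : ℕ) := fun i => (hp i).symm
  obtain ⟨hsx, hsy⟩ := sum_coordinates_pow_eq_zero hγ hγ1 hbasis hxy
  have hspan : extendCode C' =
      Submodule.span F {(Fin.snoc x 0 : Fin (q + 2) → F), Fin.snoc y 0, fun _ => 1} := by
    refine Submodule.eq_of_le_of_finrank_le ?_ ?_
    · rintro _ ⟨w, hw, rfl⟩
      obtain ⟨a, b, c, habc⟩ := exists_eq_combination_of_wordFourierCoeff hF hω hγ hγ1 hbasis hxy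
        (w := w) fun u hu hu1 h h' => hcoeff u hu hu1 h h' w hw
      have hsum : ∑ i, w i = a := by
        have hq0 : (q : F) = 0 := hF ▸ FiniteField.cast_card_eq_zero F
        simp [habc, Finset.sum_add_distrib, ← Finset.mul_sum, hsx, hsy, hq0]
      have heq : extendLM F (q + 1) w = b • (Fin.snoc x 0 : Fin (q + 2) → F) +
          c • (Fin.snoc y 0 : Fin (q + 2) → F) + a • (fun _ => 1) := by
        funext i
        refine Fin.lastCases ?_ (fun j => ?_) i
        · simp [extendLM, hsum]
        · simp only [extendLM, LinearMap.coe_mk, AddHom.coe_mk, Fin.snoc_castSucc, habc,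
            Pi.add_apply, Pi.smul_apply, smul_eq_mul]
          ring
      rw [heq]
      exact Submodule.add_mem _ (Submodule.add_mem _
        (Submodule.smul_mem _ _ (Submodule.subset_span (by simp)))
        (Submodule.smul_mem _ _ (Submodule.subset_span (by simp))))
        (Submodule.smul_mem _ _ (Submodule.subset_span (by simp)))
    · rw [hdim]
      have hle := finrank_range_le_card (R := F)
        ![(Fin.snoc x 0 : Fin (q + 2) → F), Fin.snoc y 0, fun _ => 1]
      rw [Set.finrank, Matrix.range_cons, Matrix.range_cons_cons_empty, Fintype.card_fin,
        Set.singleton_union] at hle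
      exact hle
  have horder : orderOf γ = q + 1 :=
    orderOf_eq_of_le_hammingNorm hq2 hγ hγ1 hbasis hxy (hspan ▸ hdist.1)
  have hprim : IsPrimitiveRoot γ (q + 1) := horder ▸ IsPrimitiveRoot.orderOf γ
  have hpowinj : Function.Injective fun i : Fin (q + 1) => γ ^ (i : ℕ) := fun i j h =>
    Fin.ext (hprim.pow_inj i.isLt j.isLt h)
  have hrange : (Set.range fun i : Fin (q + 1) => γ ^ (i : ℕ)) = {z : K | z ^ (q + 1) = 1} := by
    ext z
    constructor
    · rintro ⟨i, rfl⟩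
      simp only [Set.mem_ofPred_eq]
      rw [← pow_mul, mul_comm, pow_mul, hγ, one_pow]
    · intro hz
      obtain ⟨i, hi, rfl⟩ := hprim.eq_pow_of_pow_eq_one hz
      exact ⟨⟨i, hi⟩, rfl⟩
  have hγ0 : γ ≠ 0 := hprim.ne_zero (Nat.succ_ne_zero q)
  refine ⟨γ, γ, x, y, horder, hbasis, hxy, hspan, ?_, by rw [hrange], ?_,
    fun a b hb => ncard_unitCircle_union_zero_inter_line hF hK a b hb⟩
  · have hne : ∀ i, ¬ (x i = 0 ∧ y i = 0) := by
      rintro i ⟨hx, hy⟩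
      have := hxy i
      rw [hx, hy, map_zero, zero_smul, add_zero] at this
      exact pow_ne_zero _ hγ0 this.symm
    intro i j
    refine Fin.lastCases ?_ (fun i => ?_) i <;> refine Fin.lastCases ?_ (fun j => ?_) j
    · exact fun _ => rfl
    · intro h
      simp only [Fin.snoc_last, Fin.snoc_castSucc, Prod.mk.injEq] at h
      exact absurd ⟨h.1.symm, h.2.symm⟩ (hne j)
    · intro h
      simp only [Fin.snoc_last, Fin.snoc_castSucc, Prod.mk.injEq] at h
      exact absurd h (hne i)
    · intro h
      simp only [Fin.snoc_castSucc, Prod.mk.injEq] at h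
      refine congrArg Fin.castSucc (hpowinj ?_)
      simp only
      rw [← hxy i, ← hxy j, h.1, h.2]
  · rw [← hrange, Set.union_singleton, Set.ncard_insert_of_notMem, ← Set.image_univ,
      Set.ncard_image_of_injective _ hpowinj, Set.ncard_univ, Nat.card_eq_fintype_card,
      Fintype.card_fin]
    rintro ⟨i, hi⟩
    exact pow_ne_zero _ hγ0 hi
end

section
/- Let q = 2^m, F = 𝔽_q ⊆ K = 𝔽_{q²}, S = {u ∈ K : u^{q+1} = 1}, and let Λ be a subgroup of the additive group of F with |Λ| = t. Then the set D = ⋃_{λ ∈ Λ} λ·S ⊆ K, viewed as a point set of the affine plane AG(2, q) = K (K regarded as a 2-dimensional F-vector space), is a maximal {qt−q+t; t}-arc: |D| = (q+1)(t−1) + 1 = qt − q + t, and every affine line of K (every coset a + F·b with a, b ∈ K, b ≠ 0) meets D in exactly 0 or t points. -/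
/-- If `f` is an endomorphism of a finite commutative group whose range has index two, then the
preimage of a subgroup under a translate of `f` that avoids `0` is empty or has the size of that
subgroup. -/
theorem ncard_add_mem_of_range_index_eq_two {G : Type*} [AddCommGroup G] [Finite G]
    (f : G →+ G) (hf : f.range.index = 2) (H : AddSubgroup G) {a : G} (ha : a ∉ f.range) :
    {x | a + f x ∈ H}.ncard = 0 ∨ {x | a + f x ∈ H}.ncard = Nat.card H := by
  rcases Set.eq_empty_or_nonempty {x | a + f x ∈ H} with h | ⟨x₀, hx₀⟩
  · exact Or.inl (by rw [h, Set.ncard_empty])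
  right
  have htranslate : {x | a + f x ∈ H} = (x₀ + ·) '' (H.comap f : Set G) := by
    ext x
    simp only [Set.mem_ofPred_eq, Set.mem_image, SetLike.mem_coe, AddSubgroup.mem_comap] at hx₀ ⊢
    constructor
    · intro hx
      refine ⟨x - x₀, ?_, by abel⟩
      have := H.sub_mem hx hx₀
      rwa [add_sub_add_left_eq_sub, ← map_sub] at this
    · rintro ⟨y, hy, rfl⟩
      rw [map_add, ← add_assoc]
      exact H.add_mem hx₀ hy
  have hrel : f.range.relIndex H = 2 := by
    have hnle : ¬ H ≤ f.range := fun hle =>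
      ha ((add_mem_cancel_right (AddMonoidHom.mem_range.2 ⟨x₀, rfl⟩)).1 (hle hx₀))
    have hdvd : f.range.relIndex H ∣ 2 := hf ▸ AddSubgroup.relIndex_dvd_index_of_normal f.range H
    exact ((Nat.dvd_prime Nat.prime_two).1 hdvd).resolve_left
      (fun h => hnle (AddSubgroup.relIndex_eq_one.1 h))
  have hindex : (H.comap f).index = H.index := by
    have h₁ := AddSubgroup.relIndex_mul_index (inf_le_left : f.range ⊓ H ≤ f.range)
    have h₂ := AddSubgroup.relIndex_mul_index (inf_le_right : f.range ⊓ H ≤ H)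
    rw [AddSubgroup.inf_relIndex_left, hf] at h₁
    rw [AddSubgroup.inf_relIndex_right, hrel] at h₂
    rw [AddSubgroup.index_comap]
    lia
  have hcard : Nat.card (H.comap f) = Nat.card H := by
    have h₁ := (H.comap f).card_mul_index
    rw [hindex, ← H.card_mul_index] at h₁
    exact Nat.eq_of_mul_eq_mul_right (Nat.pos_of_ne_zero H.index_ne_zero_of_finite) h₁
  rw [htranslate, Set.ncard_image_of_injective _ (add_right_injective x₀), ← hcard]
  exact (Nat.card_coe_set_eq _).symm

section QuadraticExtension

variable {F K : Type*} [Field F] [Field K] [Algebra F K] [Finite K]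

theorem algebraMap_norm_eq_pow_card_add_one (h : Module.finrank F K = 2) (x : K) :
    algebraMap F K (Algebra.norm F x) = x ^ (Nat.card F + 1) := by
  rw [FiniteField.algebraMap_norm_eq_pow_sum, h]
  simp [Finset.sum_range_succ, add_comm]

theorem norm_add_algebraMap (h : Module.finrank F K = 2) (x : K) (c : F) :
    Algebra.norm F (x + algebraMap F K c) =
      Algebra.norm F x + Algebra.trace F K x * c + c ^ 2 := by
  have := Finite.of_injective _ (algebraMap F K).injective
  have := Fintype.ofFinite F
  apply (algebraMap F K).injective
  have hadd : (x + algebraMap F K c) ^ Nat.card F = x ^ Nat.card F + algebraMap F K c := by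
    have := map_add (FiniteField.frobeniusAlgHom F K) x (algebraMap F K c)
    rwa [AlgHom.commutes, FiniteField.coe_frobeniusAlgHom, Fintype.card_eq_nat_card] at this
  have htr : algebraMap F K (Algebra.trace F K x) = x + x ^ Nat.card F := by
    rw [FiniteField.algebraMap_trace_eq_sum_pow, h]
    simp [Finset.sum_range_succ]
  simp only [map_add, map_mul, map_pow, htr, algebraMap_norm_eq_pow_card_add_one h, pow_succ _
    (Nat.card F), hadd]
  ring

theorem ncard_pow_card_add_one_eq_one (h : Module.finrank F K = 2) :
    {u : K | u ^ (Nat.card F + 1) = 1}.ncard = Nat.card F + 1 := by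
  have := Finite.of_injective _ (algebraMap F K).injective
  let N : Kˣ →* Fˣ := Units.map (Algebra.norm F)
  have himage : {u : K | u ^ (Nat.card F + 1) = 1} = Units.val '' (N.ker : Set Kˣ) := by
    ext u
    simp only [Set.mem_ofPred_eq, Set.mem_image, SetLike.mem_coe, MonoidHom.mem_ker]
    have key (v : Kˣ) : N v = 1 ↔ (v : K) ^ (Nat.card F + 1) = 1 := by
      rw [← algebraMap_norm_eq_pow_card_add_one h, Units.ext_iff,
        ← (algebraMap F K).injective.eq_iff]
      simp [N]
    constructor
    · intro hu
      exact ⟨(IsUnit.of_pow_eq_one hu (Nat.succ_ne_zero _)).unit, (key _).2 hu, rfl⟩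
    · rintro ⟨v, hv, rfl⟩
      exact (key v).1 hv
  have hker := N.ker.card_mul_index
  have := Fintype.ofFinite F
  have := Fintype.ofFinite K
  have hK : Nat.card K = Nat.card F ^ 2 := by
    rw [← h, Nat.card_eq_fintype_card, Nat.card_eq_fintype_card,
      Module.card_eq_pow_finrank (K := F)]
  rw [Subgroup.index_ker, MonoidHom.range_eq_top.2 (FiniteField.unitsMap_norm_surjective F K),
    Subgroup.card_top, Nat.card_units, Nat.card_units, hK] at hker
  rw [himage, Set.ncard_image_of_injective _ Units.val_injective, ← Nat.card_coe_set_eq]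
  have hq : 1 < Nat.card F := Finite.one_lt_card
  refine Nat.eq_of_mul_eq_mul_right (Nat.sub_pos_of_lt hq) (hker.trans ?_)
  simpa using Nat.sq_sub_sq (Nat.card F) 1

theorem exists_smul_pow_eq_one_iff (h : Module.finrank F K = 2) (H : AddSubgroup F) (z : K) :
    (∃ l ∈ H, ∃ u : K, u ^ (Nat.card F + 1) = 1 ∧ z = l • u) ↔
      ∃ l ∈ H, l ^ 2 = Algebra.norm F z := by
  constructor
  · rintro ⟨l, hl, u, hu, rfl⟩
    refine ⟨l, hl, ?_⟩
    rw [← algebraMap_norm_eq_pow_card_add_one h, map_eq_one_iff _ (algebraMap F K).injective] at hu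
    rw [Algebra.smul_def, map_mul, hu, Algebra.norm_algebraMap, h, mul_one]
  · rintro ⟨l, hl, hz⟩
    refine ⟨l, hl, ?_⟩
    have := Finite.of_injective _ (algebraMap F K).injective
    have : FiniteDimensional F K := Module.finite_of_finrank_eq_succ h
    rcases eq_or_ne l 0 with rfl | h0
    · refine ⟨1, one_pow _, ?_⟩
      rw [zero_pow two_ne_zero, eq_comm, Algebra.norm_eq_zero_iff] at hz
      rw [hz, zero_smul]
    · refine ⟨l⁻¹ • z, ?_, (smul_inv_smul₀ h0 z).symm⟩
      rw [← algebraMap_norm_eq_pow_card_add_one h, Algebra.smul_def, map_mul,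
        Algebra.norm_algebraMap, h, ← hz, ← mul_pow, inv_mul_cancel₀ h0, one_pow, map_one]

variable [CharP F 2]

theorem ncard_smul_pow_eq_one (h : Module.finrank F K = 2) (H : AddSubgroup F) :
    {z : K | ∃ l ∈ H, ∃ u : K, u ^ (Nat.card F + 1) = 1 ∧ z = l • u}.ncard =
      (Nat.card F + 1) * (Nat.card H - 1) + 1 := by
  have := Finite.of_injective _ (algebraMap F K).injective
  have hunion : {z : K | ∃ l ∈ H, ∃ u : K, u ^ (Nat.card F + 1) = 1 ∧ z = l • u} =
      insert 0 ((fun p : F × K => p.1 • p.2) ''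
        (((H : Set F) \ {0}) ×ˢ {u : K | u ^ (Nat.card F + 1) = 1})) := by
    ext z
    simp only [Set.mem_ofPred_eq, Set.mem_insert_iff, Set.mem_image, Set.mem_prod, Prod.exists,
      Set.mem_sdiff, Set.mem_singleton_iff, SetLike.mem_coe]
    constructor
    · rintro ⟨l, hl, u, hu, rfl⟩
      rcases eq_or_ne l 0 with rfl | h0
      · exact Or.inl (zero_smul _ _)
      · exact Or.inr ⟨l, u, ⟨⟨hl, h0⟩, hu⟩, rfl⟩
    · rintro (rfl | ⟨l, u, ⟨⟨hl, -⟩, hu⟩, rfl⟩)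
      · exact ⟨0, H.zero_mem, 1, one_pow _, (zero_smul _ _).symm⟩
      · exact ⟨l, hl, u, hu, rfl⟩
  have hinj : Set.InjOn (fun p : F × K => p.1 • p.2)
      (((H : Set F) \ {0}) ×ˢ {u : K | u ^ (Nat.card F + 1) = 1}) := by
    rintro ⟨l, u⟩ ⟨⟨-, hl⟩, hu⟩ ⟨l', u'⟩ ⟨-, hu'⟩ heq
    simp only [Set.mem_ofPred_eq, ← algebraMap_norm_eq_pow_card_add_one h,
      map_eq_one_iff _ (algebraMap F K).injective] at hu hu' heq
    have hnorm := congrArg (Algebra.norm F) heq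
    simp only [Algebra.smul_def, map_mul, hu, hu', Algebra.norm_algebraMap, h, mul_one] at hnorm
    obtain rfl : l = l' := frobenius_inj F 2 hnorm
    rw [smul_right_injective K hl heq]
  have hzero : (0 : K) ∉ (fun p : F × K => p.1 • p.2) ''
        (((H : Set F) \ {0}) ×ˢ {u : K | u ^ (Nat.card F + 1) = 1}) := by
    rintro ⟨⟨l, u⟩, ⟨⟨-, hl⟩, hu⟩, hz⟩
    rcases smul_eq_zero.1 hz with h0 | h0
    · exact hl h0
    · simp [show u = 0 from h0] at hu
  rw [hunion, Set.ncard_insert_of_notMem hzero, hinj.ncard_image, Set.ncard_prod,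
    ncard_pow_card_add_one_eq_one h,
    Set.ncard_sdiff_singleton_of_mem (SetLike.mem_coe.2 H.zero_mem),
    ← Nat.card_coe_set_eq (H : Set F), mul_comm]
  rfl

theorem ncard_norm_mul_add_algebraMap_mem (h : Module.finrank F K = 2) (H : AddSubgroup F)
    {n : F} (hn : n ≠ 0) (w : K) :
    {c : F | n * Algebra.norm F (w + algebraMap F K c) ∈ H}.ncard = 0 ∨
      {c : F | n * Algebra.norm F (w + algebraMap F K c) ∈ H}.ncard = Nat.card H := by
  have := Finite.of_injective _ (algebraMap F K).injective
  have : FiniteDimensional F K := Module.finite_of_finrank_eq_succ h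
  let T := Algebra.trace F K w
  let f : F →+ F :=
    (AddMonoidHom.mulLeft n).comp (AddMonoidHom.mulLeft T + (frobenius F 2).toAddMonoidHom)
  have hf (c : F) : f c = n * (T * c + c ^ 2) := rfl
  have hset : {c : F | n * Algebra.norm F (w + algebraMap F K c) ∈ H} =
      {c : F | n * Algebra.norm F w + f c ∈ H} := by
    ext c
    rw [Set.mem_ofPred_eq, Set.mem_ofPred_eq, norm_add_algebraMap h, hf, ← mul_add, add_assoc]
  rw [hset]
  have hker (c : F) : c ∈ f.ker ↔ c = 0 ∨ c = T := by
    rw [AddMonoidHom.mem_ker, hf, mul_eq_zero, or_iff_right hn,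
      show T * c + c ^ 2 = c * (c + T) by ring, mul_eq_zero, CharTwo.add_eq_zero]
  by_cases hT : T = 0
  · right
    have hinj : Function.Injective f := by
      refine (injective_iff_map_eq_zero f).2 fun c hc => ?_
      simpa [hT] using (hker c).1 hc
    have hbij : Function.Bijective fun c => n * Algebra.norm F w + f c :=
      Finite.injective_iff_bijective.1 ((add_right_injective _).comp hinj)
    exact (Set.ncard_preimage_of_injective_subset_range hbij.1
      (hbij.2.range_eq ▸ Set.subset_univ (H : Set F))).trans (Nat.card_coe_set_eq _).symm
  · refine ncard_add_mem_of_range_index_eq_two f ?_ H ?_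
    · have : (f.ker : Set F) = {0, T} := by
        ext c
        simpa using hker c
      rw [AddSubgroup.index_range, ← Set.ncard_pair (Ne.symm hT), ← this]
      exact Nat.card_coe_set_eq _
    · rintro ⟨c, hc⟩
      have hnorm : Algebra.norm F (w + algebraMap F K c) = 0 := by
        rw [hf, mul_right_inj' hn] at hc
        rw [norm_add_algebraMap h, add_assoc, CharTwo.add_eq_zero]
        exact hc.symm
      rw [Algebra.norm_eq_zero_iff, add_eq_zero_iff_eq_neg, ← map_neg] at hnorm
      apply hT
      simp only [T, hnorm, Algebra.trace_algebraMap, h, nsmul_eq_mul, Nat.cast_ofNat,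
        CharTwo.two_eq_zero, zero_mul]

end QuadraticExtension

/-- **Denniston maximal arcs in polar form.**  Let `q = 2^m`, `F = 𝔽_q ⊆ K = 𝔽_{q²}`,
`S = {u ∈ K : u^(q+1) = 1}`, and let `Λ` be a subgroup of the additive group of `F` with
`|Λ| = t`.  Then `D = ⋃_{λ ∈ Λ} λ·S ⊆ K`, viewed in the affine plane `AG(2,q) = K`, is a
maximal `{qt−q+t; t}`-arc: `|D| = (q+1)(t−1)+1` and every affine line `a + F·b` (`b ≠ 0`)
meets `D` in exactly `0` or `t` points. -/
theorem denniston_arc_polar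
    (m q t : ℕ) (hm : 1 ≤ m) (hq : q = 2 ^ m)
    (F K : Type*) [Field F] [Fintype F] [Field K] [Fintype K] [Algebra F K]
    (hF : Fintype.card F = q) (hK : Fintype.card K = q ^ 2)
    (Λ : AddSubgroup F) (ht : Nat.card Λ = t)
    (D : Set K)
    (hD : D = {z : K | ∃ l ∈ Λ, ∃ u : K, u ^ (q + 1) = 1 ∧ z = l • u}) :
    D.ncard = (q + 1) * (t - 1) + 1 ∧
    ∀ a b : K, b ≠ 0 →
      (D ∩ {z : K | ∃ c : F, z = a + c • b}).ncard = 0 ∨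
      (D ∩ {z : K | ∃ c : F, z = a + c • b}).ncard = t := by
  have hfin : Module.finrank F K = 2 := by
    have := Module.card_eq_pow_finrank (K := F) (V := K)
    rw [hK, hF] at this
    exact (Nat.pow_right_injective (hF ▸ Fintype.one_lt_card) this).symm
  have hchar : CharP F 2 := by
    have := Fact.mk Nat.prime_two
    exact charP_of_card_eq_prime_pow (hF.trans hq)
  rw [Fintype.card_eq_nat_card] at hF
  subst hF ht hD
  refine ⟨ncard_smul_pow_eq_one hfin Λ, fun a b hb => ?_⟩
  have : FiniteDimensional F K := Module.finite_of_finrank_eq_succ hfin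
  let σ : F →+ F := (frobenius F 2).toAddMonoidHom
  have hσ : Function.Injective σ := frobenius_inj F 2
  have hline : {z : K | ∃ l ∈ Λ, ∃ u : K, u ^ (Nat.card F + 1) = 1 ∧ z = l • u} ∩
      {z : K | ∃ c : F, z = a + c • b} = (fun c : F => a + c • b) ''
        {c : F | Algebra.norm F b * Algebra.norm F (a / b + algebraMap F K c) ∈ Λ.map σ} := by
    ext z
    simp only [Set.mem_inter_iff, Set.mem_ofPred_eq, exists_smul_pow_eq_one_iff hfin, Set.mem_image,
      ← map_mul, mul_add, mul_div_cancel₀ a hb, AddSubgroup.mem_map]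
    constructor
    · rintro ⟨hz, c, rfl⟩
      exact ⟨c, by rwa [mul_comm, ← Algebra.smul_def], rfl⟩
    · rintro ⟨c, hz, rfl⟩
      exact ⟨by rwa [mul_comm, ← Algebra.smul_def] at hz, c, rfl⟩
  have hinj : Function.Injective fun c : F => a + c • b :=
    (add_right_injective a).comp (smul_left_injective F hb)
  rw [hline, Set.ncard_image_of_injective _ hinj, ← AddSubgroup.card_map_of_injective hσ]
  exact ncard_norm_mul_add_algebraMap_mem hfin _ (Algebra.norm_ne_zero_iff.2 hb) _
end

section
/- Let t = 2^r > 1 and q = t^k be powers of 2 with t < q and 𝔽_t a subfield of F = 𝔽_q, let K = 𝔽_{q²}, and N = (q+1)(t−1). Then the set D = {x ∈ K : x^N = 1} ∪ {0}, viewed as a point set of the affine plane AG(2, q) = K, is a maximal {qt−q+t; t}-arc: |D| = N + 1 = qt − q + t, and every affine line of K (every coset a + F·b with a, b ∈ K, b ≠ 0) meets D in exactly 0 or t points. (This is the cyclic Denniston maximal arc.) -/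
/-- In a finite field `E`, if `m` divides `|E| - 1`, then zero together with the `m`-th roots of
unity forms a set of `m + 1` elements. -/
theorem ncard_pow_eq_one_union_zero {E : Type*} [Field E] [Fintype E] {m : ℕ} (hm : 0 < m)
    (hdvd : m ∣ Fintype.card E - 1) : ({x : E | x ^ m = 1} ∪ {0}).ncard = m + 1 := by
  have himage : {x : E | x ^ m = 1} = Units.val '' ((powMonoidHom m : Eˣ →* Eˣ).ker : Set Eˣ) := by
    ext x
    simp only [Set.mem_ofPred_eq, Set.mem_image, SetLike.mem_coe, MonoidHom.mem_ker,
      powMonoidHom_apply]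
    constructor
    · intro hx
      have hx0 : x ≠ 0 := by
        rintro rfl
        simp [hm.ne'] at hx
      exact ⟨Units.mk0 x hx0, by ext; simpa using hx, rfl⟩
    · rintro ⟨y, hy, rfl⟩
      simpa using congrArg Units.val hy
  have hcard : {x : E | x ^ m = 1}.ncard = m := by
    rw [himage, Set.ncard_image_of_injective _ Units.val_injective, ← Nat.card_coe_set_eq]
    refine (IsCyclic.card_powMonoidHom_ker _ m).trans ?_
    rw [Nat.card_units, Nat.card_eq_fintype_card]
    exact Nat.gcd_eq_right hdvd
  rw [Set.union_singleton, Set.ncard_insert_of_notMem (by simp [hm.ne']) (Set.toFinite _), hcard]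

/-- If an additive endomorphism of a finite commutative group has a kernel of order two, then the
preimage of any subgroup not contained in its range has the same order as the subgroup. -/
theorem card_comap_of_card_ker_eq_two {G : Type*} [AddCommGroup G] [Finite G] (f : G →+ G)
    (hker : Nat.card f.ker = 2) (A : AddSubgroup G) {u : G} (huA : u ∈ A) (hu : u ∉ f.range) :
    Nat.card (A.comap f) = Nat.card A := by
  have hkerindex := f.ker.card_mul_index
  rw [AddSubgroup.index_ker, hker] at hkerindex
  have hrange := f.range.card_mul_index
  have hpos : 0 < Nat.card f.range := Nat.card_pos
  have hindex : f.range.index = 2 := by nlinarith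
  have hrel : f.range.relIndex A = 2 := by
    rw [AddSubgroup.relIndex_eq_two_iff_exists_notMem_and]
    refine ⟨u, huA, hu, fun b _ => ?_⟩
    rw [AddSubgroup.add_mem_iff_of_index_two hindex]
    tauto
  have h₁ := (f.range.addSubgroupOf A).card_mul_index
  have h₂ := (A.addSubgroupOf f.range).card_mul_index
  have h₃ := (A.comap f).card_mul_index
  rw [AddSubgroup.index_comap] at h₃
  change _ * f.range.relIndex A = _ at h₁
  change _ * A.relIndex f.range = _ at h₂
  have h₄ : Nat.card (f.range.addSubgroupOf A) = Nat.card (A.addSubgroupOf f.range) := by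
    rw [← AddSubgroup.inf_addSubgroupOf_right, ← AddSubgroup.inf_addSubgroupOf_right A]
    rw [Nat.card_congr (AddSubgroup.addSubgroupOfEquivOfLe inf_le_right).toEquiv,
      Nat.card_congr (AddSubgroup.addSubgroupOfEquivOfLe inf_le_right).toEquiv, inf_comm]
  rw [hrel] at h₁
  have hrelpos : 0 < A.relIndex f.range := by
    refine Nat.pos_of_ne_zero fun h => ?_
    rw [h] at h₂
    omega
  refine Nat.eq_of_mul_eq_mul_right hrelpos ?_
  rw [h₃, ← hkerindex, ← h₂, ← h₁, h₄]
  ring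

/-- In characteristic two, the additive map `x ↦ n x² + s x`. -/
def quadraticAddHom {F : Type*} [Field F] [CharP F 2] (n s : F) : F →+ F where
  toFun c := n * c ^ 2 + s * c
  map_zero' := by simp
  map_add' x y := by
    rw [CharTwo.add_sq]
    ring

theorem card_ker_quadraticAddHom {F : Type*} [Field F] [CharP F 2] {n s : F} (hn : n ≠ 0)
    (hs : s ≠ 0) : Nat.card (quadraticAddHom n s).ker = 2 := by
  have hker : ((quadraticAddHom n s).ker : Set F) = {0, s / n} := by
    ext c
    simp only [SetLike.mem_coe, AddMonoidHom.mem_ker, Set.mem_insert_iff, Set.mem_singleton_iff]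
    change n * c ^ 2 + s * c = 0 ↔ _
    rw [show n * c ^ 2 + s * c = c * (n * c + s) by ring, mul_eq_zero, CharTwo.add_eq_zero,
      eq_div_iff hn, mul_comm c n]
  rw [← SetLike.coe_sort_coe, hker, Nat.card_coe_set_eq,
    Set.ncard_pair (div_ne_zero hs hn).symm]

theorem card_comap_quadraticAddHom_zero {F : Type*} [Field F] [Finite F] [CharP F 2] {n : F}
    (hn : n ≠ 0) (A : AddSubgroup F) :
    Nat.card (A.comap (quadraticAddHom n 0)) = Nat.card A := by
  have hinj : Function.Injective (quadraticAddHom n 0) := by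
    rw [injective_iff_map_eq_zero]
    intro c hc
    change n * c ^ 2 + 0 * c = 0 at hc
    simpa [hn] using hc
  exact Nat.card_congr
    ((Equiv.ofBijective _ (Finite.injective_iff_bijective.mp hinj)).subtypeEquiv fun _ => Iff.rfl)

/-- In characteristic `p`, the additive subgroup of elements fixed by `x ↦ x ^ p ^ r`. -/
def fixedByIterateFrobenius (F : Type*) [Field F] (p r : ℕ) [Fact p.Prime] [CharP F p] :
    AddSubgroup F where
  carrier := {x | x ^ p ^ r = x}
  zero_mem' := zero_pow (pow_ne_zero _ (Fact.out : p.Prime).ne_zero)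
  add_mem' {x y} hx hy := by
    simp only [Set.mem_ofPred_eq] at *
    rw [add_pow_char_pow, hx, hy]
  neg_mem' {x} hx := by
    have h := map_neg (iterateFrobenius F p r) x
    simp only [Set.mem_ofPred_eq, iterateFrobenius_def] at *
    rw [h, hx]

theorem pow_succ_eq_self_iff {E : Type*} [Field E] (m : ℕ) (x : E) :
    x ^ (m + 1) = x ↔ x ∈ {x : E | x ^ m = 1} ∪ {0} := by
  by_cases hx : x = 0
  · simp [hx]
  · simp [hx, pow_succ]


/-- **Cyclic Denniston maximal arc.**  Let `t = 2^r`, `1 < t < q`, `q = t^k`,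
`F = 𝔽_q ⊆ K = 𝔽_{q²}` and `N = (q+1)(t−1)`.  Then `D = {x ∈ K : x^N = 1} ∪ {0}`, viewed
in the affine plane `AG(2,q) = K`, is a maximal `{qt−q+t; t}`-arc: `|D| = N+1` and every
affine line `a + F·b` (`b ≠ 0`) meets `D` in exactly `0` or `t` points. -/
theorem cyclic_denniston_arc
    (r k t q N : ℕ) (hr : 1 ≤ r) (ht : t = 2 ^ r) (ht1 : 1 < t) (hk : 1 ≤ k)
    (hq : q = t ^ k) (htq : t < q) (hN : N = (q + 1) * (t - 1))
    (F K : Type*) [Field F] [Fintype F] [Field K] [Fintype K] [Algebra F K]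
    (hF : Fintype.card F = q) (hK : Fintype.card K = q ^ 2)
    (D : Set K) (hD : D = {x : K | x ^ N = 1} ∪ {0}) :
    D.ncard = N + 1 ∧
    ∀ a b : K, b ≠ 0 →
      (D ∩ {z : K | ∃ c : F, z = a + c • b}).ncard = 0 ∨
      (D ∩ {z : K | ∃ c : F, z = a + c • b}).ncard = t := by
  have hq0 : 0 < q := by omega
  have : CharP F 2 := by
    refine charP_of_card_eq_prime_pow (p := 2) (f := r * k) ?_
    rw [hF, hq, ht, pow_mul]
  have : CharP K 2 := charP_of_injective_algebraMap (algebraMap F K).injective 2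
  have htdvd : t - 1 ∣ q - 1 := by
    simpa [hq] using Nat.sub_dvd_pow_sub_pow t 1 k
  have hNpos : 0 < N := by
    rw [hN]
    exact Nat.mul_pos (by omega) (by omega)
  have hNdvd : N ∣ Fintype.card K - 1 := by
    rw [hK, hN, show q ^ 2 - 1 = (q + 1) * (q - 1) by simpa using Nat.sq_sub_sq q 1]
    exact Nat.mul_dvd_mul_left _ htdvd
  refine ⟨hD ▸ ncard_pow_eq_one_union_zero hNpos hNdvd, fun a b hb => ?_⟩
  let A := fixedByIterateFrobenius F 2 r
  have memA (x : F) : x ∈ A ↔ x ^ t = x := by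
    rw [ht]
    rfl
  have hAcard : Nat.card A = t := by
    have hA : (A : Set F) = {x : F | x ^ (t - 1) = 1} ∪ {0} := by
      ext x
      rw [SetLike.mem_coe, memA, ← pow_succ_eq_self_iff, Nat.sub_add_cancel ht1.le]
    rw [← SetLike.coe_sort_coe, hA, Nat.card_coe_set_eq,
      ncard_pow_eq_one_union_zero (by omega) (hF ▸ htdvd)]
    omega
  have hfin : Module.finrank F K = 2 := by
    have h := Module.card_eq_pow_finrank (K := F) (V := K)
    rw [hK, hF] at h
    exact (Nat.pow_right_injective (by omega : 2 ≤ q) h).symm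
  have hnorm (x : K) : algebraMap F K (Algebra.norm F x) = x * x ^ q := by
    rw [FiniteField.algebraMap_norm_eq_prod_pow, hfin, Nat.card_eq_fintype_card, hF]
    simp [Finset.prod_range_succ]
  have htrace (x : K) : algebraMap F K (Algebra.trace F K x) = x + x ^ q := by
    rw [FiniteField.algebraMap_trace_eq_sum_pow, hfin, Nat.card_eq_fintype_card, hF]
    simp [Finset.sum_range_succ]
  have memD (x : K) : x ∈ D ↔ Algebra.norm F x ∈ A := by
    rw [memA, ← Nat.sub_add_cancel ht1.le, pow_succ_eq_self_iff, hD]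
    simp only [Set.mem_union, Set.mem_ofPred_eq, Set.mem_singleton_iff, Algebra.norm_eq_zero_iff]
    rw [← (algebraMap F K).injective.eq_iff, map_pow, map_one, hnorm, ← pow_succ', ← pow_mul, hN]
  have hqq (x : K) : (x ^ q) ^ q = x := by
    rw [← pow_mul, ← sq, ← hK, FiniteField.pow_card]
  have hfrob (x y : K) : (x + y) ^ q = x ^ q + y ^ q := by
    rw [hq, ht, ← pow_mul, add_pow_char_pow]
  have hcq (c : F) : algebraMap F K c ^ q = algebraMap F K c := by
    rw [← map_pow, ← hF, FiniteField.pow_card]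
  rcases Set.eq_empty_or_nonempty (D ∩ {z : K | ∃ c : F, z = a + c • b}) with hempty | hne
  · exact Or.inl (by rw [hempty, Set.ncard_empty])
  right
  obtain ⟨z, hzD, c₀, hz⟩ := hne
  rw [memD] at hzD
  set L := quadraticAddHom (Algebra.norm F b) (Algebra.trace F K (z * b ^ q)) with hL
  have hexpand (c : F) : Algebra.norm F (z + c • b) = Algebra.norm F z + L c := by
    apply (algebraMap F K).injective
    change _ = algebraMap F K (_ + (_ * c ^ 2 + _ * c))
    simp only [map_add, map_mul, map_pow, hnorm, htrace, Algebra.smul_def, hfrob, mul_pow, hcq,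
      hqq]
    ring
  have hset : D ∩ {z : K | ∃ c : F, z = a + c • b} =
      (fun c : F => z + c • b) '' (A.comap L : Set F) := by
    ext x
    simp only [Set.mem_inter_iff, Set.mem_ofPred_eq, Set.mem_image, SetLike.mem_coe,
      AddSubgroup.mem_comap, memD]
    have key (c : F) : Algebra.norm F (z + c • b) ∈ A ↔ L c ∈ A := by
      rw [hexpand, AddSubgroup.add_mem_cancel_left _ hzD]
    constructor
    · rintro ⟨hx, c, rfl⟩
      have hc : z + (c - c₀) • b = a + c • b := by
        rw [hz, sub_smul]
        abel
      exact ⟨c - c₀, (key _).mp (hc ▸ hx), hc⟩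
    · rintro ⟨c, hc, rfl⟩
      exact ⟨(key c).mpr hc, c₀ + c, by rw [hz, add_smul, add_assoc]⟩
  have hinj : Function.Injective fun c : F => z + c • b :=
    (add_right_injective z).comp (smul_left_injective F hb)
  have hnb : Algebra.norm F b ≠ 0 := Algebra.norm_ne_zero_iff.mpr hb
  rw [hset, Set.ncard_image_of_injective _ hinj, ← Nat.card_coe_set_eq, SetLike.coe_sort_coe,
    ← hAcard]
  by_cases hs : Algebra.trace F K (z * b ^ q) = 0
  · rw [hL, hs]
    exact card_comap_quadraticAddHom_zero hnb A
  · refine card_comap_of_card_ker_eq_two L (card_ker_quadraticAddHom hnb hs) A hzD ?_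
    rintro ⟨c, hc⟩
    have hzero : z + c • b = 0 := by
      rw [← Algebra.norm_eq_zero_iff (R := F), hexpand, hc, CharTwo.add_self_eq_zero]
    have hzc : z = c • b := by rwa [CharTwo.add_eq_zero] at hzero
    apply hs
    apply (algebraMap F K).injective
    rw [htrace, hzc, map_zero, Algebra.smul_def]
    simp only [mul_pow, hcq, hqq]
    rw [CharTwo.add_eq_zero]
    ring
end

section
/- Let q = 2^m, 1 < t < q, N = (q+1)(t−1), F = 𝔽_q, K = 𝔽_{q²}. Suppose C is an extended cyclic code over F with parameters [N+1, 3, N+1−t] whose dual code C⊥ has minimum distance at least 3. Then N divides q²−1, and there exist a generator γ of the cyclic group S' = {x ∈ K : x^N = 1} (so γ has multiplicative order N) and an F-basis {1, ξ} of K such that, writing γ^{−i} = x_i + y_i·ξ with x_i, y_i ∈ F, the code C equals the row space of the 3×(N+1) matrix whose columns are (x_i, y_i, 1) for i = 0, …, N−1 followed by (0, 0, 1); moreover the point set {γ^{−i} : 0 ≤ i ≤ N−1} ∪ {0} = {x ∈ K : x^N = 1} ∪ {0} ⊆ K is a cyclic Denniston maximal arc, i.e. a set of N+1 affine points of AG(2,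 q) = K meeting every affine line in exactly 0 or t points. -/
/-- The dual code `C⊥ = {x : Σ_i x_i c_i = 0 for all c ∈ C}`. -/
def dualCode {F : Type*} [Field F] {n : ℕ} (C : Submodule F (Fin n → F)) :
    Submodule F (Fin n → F) where
  carrier := {x | ∀ c ∈ C, ∑ i, x i * c i = 0}
  add_mem' := by
    intro a b ha hb c hc
    simpa [add_mul, Finset.sum_add_distrib] using by rw [ha c hc, hb c hc, add_zero]
  zero_mem' := by intro c hc; simp
  smul_mem' := by
    intro a x hx c hc
    simp only [Pi.smul_apply, smul_eq_mul, mul_assoc, ← Finset.mul_sum, hx c hc, mul_zero]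


open Polynomial in
/-- A monic quadratic without roots in `F` acquires a root in every extension of even degree. -/
theorem exists_sq_eq_of_no_root {F K : Type*} [Field F] [Finite F] [Field K] [Algebra F K]
    [Finite K] (hK : 2 ∣ Module.finrank F K) (p s : F)
    (hroot : ∀ b : F, b ^ 2 ≠ p + s * b) :
    ∃ β : K, β ^ 2 = algebraMap F K p + s • β := by
  set f : F[X] := X ^ 2 - C s * X - C p with hf
  have hdeg : f.natDegree = 2 := by rw [hf]; compute_degree!
  have hirr : Irreducible f := by
    refine irreducible_of_degree_le_three_of_not_isRoot (by simp [hdeg]) fun b hb => hroot b ?_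
    simp only [hf, IsRoot.def, eval_sub, eval_pow, eval_X, eval_mul, eval_C] at hb
    linear_combination hb
  have : Fact (Irreducible f) := ⟨hirr⟩
  have hfin : Module.finrank F (AdjoinRoot f) = 2 := by
    rw [← hdeg]; exact finrank_quotient_span_eq_natDegree
  obtain ⟨φ⟩ := FiniteField.nonempty_algHom_of_finrank_dvd (F := F) (K := AdjoinRoot f) (L := K)
    (hfin ▸ hK)
  refine ⟨φ (AdjoinRoot.root f), ?_⟩
  have h := AdjoinRoot.eval₂_root f
  simp only [hf, eval₂_sub, eval₂_pow, eval₂_X, eval₂_mul, eval₂_C] at h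
  have h2 := congrArg φ h
  have h3 (a : F) : φ (AdjoinRoot.of f a) = algebraMap F K a := φ.commutes a
  simp only [map_sub, map_pow, map_mul, map_zero, h3] at h2
  rw [Algebra.smul_def]
  linear_combination h2

/-- Joint evaluation of the words of a code at two positions. -/
def evalPair {F : Type*} [Field F] {n : ℕ} (C : Submodule F (Fin n → F)) (i j : Fin n) :
    C →ₗ[F] F × F :=
  ((LinearMap.proj i).prod (LinearMap.proj j)).comp C.subtype

theorem evalPair_apply {F : Type*} [Field F] {n : ℕ} (C : Submodule F (Fin n → F))
    (i j : Fin n) (c : C) : evalPair C i j c = (c.1 i, c.1 j) := rfl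

theorem evalPair_range {F : Type*} [Field F] [DecidableEq F] {n : ℕ}
    {C : Submodule F (Fin n → F)} (hdual : ∀ c ∈ dualCode C, c ≠ 0 → 3 ≤ hammingNorm c)
    {i j : Fin n} (hij : i ≠ j) : LinearMap.range (evalPair C i j) = ⊤ := by
  by_contra hne
  obtain ⟨f, hf0, hf⟩ := Submodule.exists_le_ker_of_lt_top _ (lt_top_iff_ne_top.2 hne)
  have hfa (u v : F) : f (u, v) = u * f (1, 0) + v * f (0, 1) := by
    have : ((u, v) : F × F) = u • (1, 0) + v • (0, 1) := by simp
    rw [this, map_add, map_smul, map_smul, smul_eq_mul, smul_eq_mul]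
  set w : Fin n → F := Pi.single i (f (1, 0)) + Pi.single j (f (0, 1)) with hw
  have hwC : w ∈ dualCode C := by
    intro c hc
    have h := hf ⟨⟨c, hc⟩, rfl⟩
    rw [LinearMap.mem_ker, evalPair_apply, hfa] at h
    simp only [hw, Pi.add_apply, add_mul, Finset.sum_add_distrib, Pi.single_apply, ite_mul,
      zero_mul, Finset.sum_ite_eq', Finset.mem_univ, if_true]
    linear_combination h
  have hw0 : w ≠ 0 := by
    intro h0
    apply hf0
    have hi := congrFun h0 i
    have hj := congrFun h0 j
    simp only [hw, Pi.add_apply, Pi.single_eq_same, Pi.single_eq_of_ne hij,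
      Pi.single_eq_of_ne hij.symm, add_zero, zero_add, Pi.zero_apply] at hi hj
    refine LinearMap.ext fun p => ?_
    rw [show p = (p.1, p.2) from rfl, hfa, hi, hj]
    simp
  have h3 := hdual w hwC hw0
  have h2 : hammingNorm w ≤ ({i, j} : Finset (Fin n)).card := by
    refine Finset.card_le_card fun k hk => ?_
    rw [Finset.mem_filter] at hk
    by_contra hk'
    simp only [Finset.mem_insert, Finset.mem_singleton, not_or] at hk'
    exact hk.2 (by simp [hw, Pi.single_eq_of_ne hk'.1, Pi.single_eq_of_ne hk'.2])
  have := h2.trans Finset.card_le_two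
  omega

theorem finrank_vanish_pair {F : Type*} [Field F] [DecidableEq F] {n : ℕ}
    {C : Submodule F (Fin n → F)} (hdim : Module.finrank F C = 3)
    (hdual : ∀ c ∈ dualCode C, c ≠ 0 → 3 ≤ hammingNorm c) {i j : Fin n} (hij : i ≠ j) :
    Module.finrank F ↥(C ⊓ (LinearMap.ker (LinearMap.proj i : (Fin n → F) →ₗ[F] F) ⊓
      LinearMap.ker (LinearMap.proj j : (Fin n → F) →ₗ[F] F))) = 1 := by
  have h1 := (evalPair C i j).finrank_range_add_finrank_ker
  rw [evalPair_range hdual hij, finrank_top, Module.finrank_prod, Module.finrank_self, hdim] at h1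
  rw [← LinearMap.ker_prod, ← Submodule.map_comap_subtype, ← LinearMap.ker_comp,
    Submodule.finrank_map_subtype_eq]
  change Module.finrank F (LinearMap.ker (evalPair C i j)) = 1
  omega

theorem finrank_vanish {F : Type*} [Field F] [DecidableEq F] {n : ℕ} (hn : 2 ≤ n)
    {C : Submodule F (Fin n → F)} (hdim : Module.finrank F C = 3)
    (hdual : ∀ c ∈ dualCode C, c ≠ 0 → 3 ≤ hammingNorm c) (j : Fin n) :
    Module.finrank F ↥(C ⊓ LinearMap.ker (LinearMap.proj j : (Fin n → F) →ₗ[F] F)) = 2 := by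
  have : Nontrivial (Fin n) := Fin.nontrivial_iff_two_le.2 hn
  obtain ⟨i, hij⟩ := exists_ne j
  let e : C →ₗ[F] F := (LinearMap.snd F F F).comp (evalPair C i j)
  have he : LinearMap.range e = ⊤ := by
    rw [LinearMap.range_comp, evalPair_range hdual hij, Submodule.map_top]
    exact LinearMap.range_eq_top.2 Prod.snd_surjective
  have h1 := e.finrank_range_add_finrank_ker
  rw [he, finrank_top, Module.finrank_self, hdim] at h1
  rw [← Submodule.map_comap_subtype, ← LinearMap.ker_comp, Submodule.finrank_map_subtype_eq]
  change Module.finrank F (LinearMap.ker e) = 2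
  omega

theorem card_filter_mem_eq_pow_finrank {F V : Type*} [Field F] [Fintype F] [AddCommGroup V]
    [Module F V] [Fintype V] (W : Submodule F V) [DecidablePred (· ∈ W)] :
    (Finset.univ.filter (· ∈ W)).card = Fintype.card F ^ Module.finrank F W := by
  rw [← Fintype.card_subtype, ← Module.card_eq_pow_finrank]

/-- In a three-dimensional code whose length is that of a maximal arc of degree `t`, a nonzero
word with a zero coordinate has exactly `t` of them. -/
theorem card_zeros_eq {F : Type*} [Field F] [Fintype F] [DecidableEq F] {n q t : ℕ}
    (ht : 1 < t) (hn : n = (q + 1) * (t - 1) + 1) (hF : Fintype.card F = q)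
    {C : Submodule F (Fin n → F)} (hdim : Module.finrank F C = 3)
    (hdist : ∀ c ∈ C, c ≠ 0 → n - t ≤ hammingNorm c)
    (hdual : ∀ c ∈ dualCode C, c ≠ 0 → 3 ≤ hammingNorm c)
    {c : Fin n → F} (hc : c ∈ C) (hc0 : c ≠ 0) {j : Fin n} (hj : c j = 0) :
    (Finset.univ.filter fun i => c i = 0).card = t := by
  classical
  have hq : 2 ≤ q := hF ▸ Fintype.one_lt_card
  obtain ⟨r, rfl⟩ : ∃ r, t = r + 1 := ⟨t - 1, by omega⟩
  simp only [Nat.add_sub_cancel] at hn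
  have hr : 1 ≤ r := by omega
  have hn2 : 2 ≤ n := by nlinarith
  let s : Finset (Fin n → F) := Finset.univ.filter fun d => (d ∈ C ∧ d j = 0) ∧ d ≠ 0
  let u : Finset (Fin n) := Finset.univ.erase j
  have hs : s.card = q ^ 2 - 1 := by
    have h : s = (Finset.univ.filter (· ∈ C ⊓ LinearMap.ker
        (LinearMap.proj j : (Fin n → F) →ₗ[F] F))).erase 0 := by
      ext d; simp [s, and_comm]
    rw [h, Finset.card_erase_of_mem (by simp [C.zero_mem]), card_filter_mem_eq_pow_finrank,
      finrank_vanish hn2 hdim hdual, hF]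
  have hcol : ∀ i ∈ u, (s.filter fun d => d i = 0).card = q - 1 := by
    intro i hi
    have h : (s.filter fun d => d i = 0) = (Finset.univ.filter (· ∈ C ⊓
        (LinearMap.ker (LinearMap.proj i : (Fin n → F) →ₗ[F] F) ⊓
          LinearMap.ker (LinearMap.proj j : (Fin n → F) →ₗ[F] F)))).erase 0 := by
      ext d; simp [s]; tauto
    rw [h, Finset.card_erase_of_mem (by simp [C.zero_mem]), card_filter_mem_eq_pow_finrank,
      finrank_vanish_pair hdim hdual (Finset.ne_of_mem_erase hi), hF, pow_one]
  have hsplit (d : Fin n → F) (hd : d j = 0) :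
      (u.filter fun i => d i = 0).card + 1 = (Finset.univ.filter fun i => d i = 0).card := by
    rw [Finset.filter_erase, Finset.card_erase_add_one (by simp [hd])]
  have hrow : ∀ d ∈ s, (u.filter fun i => d i = 0).card ≤ r := by
    intro d hd
    simp only [s, Finset.mem_filter, Finset.mem_univ, true_and] at hd
    have h1 := hdist d hd.1.1 hd.2
    have h2 := hsplit d hd.1.2
    have h3 : (Finset.univ.filter fun i => d i = 0).card + hammingNorm d = n := by
      simpa [hammingNorm] using Finset.card_filter_add_card_filter_not (s := Finset.univ) (fun i => d i = 0)
    omega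
  have hcount : ∑ d ∈ s, (u.filter fun i => d i = 0).card = ∑ _d ∈ s, r := by
    have h := Finset.sum_card_bipartiteAbove_eq_sum_card_bipartiteBelow
      (s := s) (t := u) (fun d i => d i = 0)
    simp only [Finset.bipartiteAbove, Finset.bipartiteBelow] at h
    rw [h, Finset.sum_congr rfl hcol, Finset.sum_const, Finset.sum_const, hs,
      Finset.card_erase_of_mem (Finset.mem_univ j), Finset.card_univ, Fintype.card_fin, hn,
      Nat.add_sub_cancel, smul_eq_mul, smul_eq_mul]
    have : q ^ 2 - 1 = (q + 1) * (q - 1) := by simpa using Nat.sq_sub_sq q 1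
    rw [this]; ring
  have hcs : c ∈ s := by simp [s, hc, hc0, hj]
  rw [← hsplit c hj, (Finset.sum_eq_sum_iff_of_le hrow).1 hcount c hcs]

/-- The first `N` coordinates of a word of length `N + 1`, repeated with period `N`. -/
def periodicCoord {F : Type*} {N : ℕ} [NeZero N] (c : Fin (N + 1) → F) (i : ℕ) : F :=
  c (Fin.ofNat N i).castSucc

theorem periodicCoord_val {F : Type*} {N : ℕ} [NeZero N] (c : Fin (N + 1) → F) (i : Fin N) :
    periodicCoord c i = c i.castSucc := by
  simp [periodicCoord]

theorem periodicCoord_self {F : Type*} {N : ℕ} [NeZero N] (c : Fin (N + 1) → F) :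
    periodicCoord c N = periodicCoord c 0 := by
  simp [periodicCoord]

theorem ext_periodicCoord {F : Type*} {N : ℕ} [NeZero N] {c d : Fin (N + 1) → F}
    (hlast : c (Fin.last N) = d (Fin.last N))
    (h : ∀ i, periodicCoord c i = periodicCoord d i) : c = d := by
  funext i
  refine Fin.lastCases hlast (fun j => ?_) i
  rw [← periodicCoord_val c, ← periodicCoord_val d, h]

theorem IsCyclicCode.rotate_mem {F : Type*} [Field F] {N : ℕ} [NeZero N]
    {C : Submodule F (Fin N → F)} (hC : IsCyclicCode C) {c : Fin N → F} (hc : c ∈ C)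
    (a : Fin N) : (fun i => c (i + a)) ∈ C := by
  have hpos : 0 < N := NeZero.pos N
  have hstep : ∀ j : ℕ, (fun i => c (i + Fin.ofNat N (j * (N - 1)))) ∈ C := by
    intro j
    induction j with
    | zero => simpa using hc
    | succ j ih =>
      convert hC _ ih using 3 with i
      refine Fin.ext ?_
      simp only [Fin.val_add, Fin.val_ofNat, Nat.add_mod_mod, Nat.mod_add_mod]
      congr 1
      rw [Nat.succ_mul]
      omega
  convert hstep (a * (N - 1)) using 3 with i
  refine congrArg (i + ·) (Fin.ext ?_)
  obtain ⟨M, rfl⟩ : ∃ M, N = M + 1 := ⟨N - 1, by omega⟩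
  rw [Fin.val_ofNat, Nat.add_sub_cancel]
  conv_lhs => rw [← Nat.mod_eq_of_lt a.isLt]
  refine (Nat.modEq_iff_dvd).2 ⟨(a : ℤ) * (M - 1), ?_⟩
  push_cast
  ring

theorem mem_extendCode {F : Type*} [Field F] {N : ℕ} {C : Submodule F (Fin N → F)}
    {c : Fin (N + 1) → F} :
    c ∈ extendCode C ↔ (fun i : Fin N => c i.castSucc) ∈ C ∧
      c (Fin.last N) = ∑ i : Fin N, c i.castSucc := by
  constructor
  · rintro ⟨d, hd, rfl⟩
    simpa [extendLM] using hd
  · rintro ⟨h1, h2⟩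
    refine ⟨_, h1, ?_⟩
    change Fin.snoc (α := fun _ => F) (fun i : Fin N => c i.castSucc)
      (∑ i : Fin N, c i.castSucc) = c
    rw [← h2]
    exact Fin.snoc_init_self c

theorem exists_shift_of_isCyclicCode {F : Type*} [Field F] {N : ℕ} [NeZero N]
    {C : Submodule F (Fin N → F)} (hC : IsCyclicCode C) {c : Fin (N + 1) → F}
    (hc : c ∈ extendCode C) :
    ∃ d ∈ extendCode C, d (Fin.last N) = c (Fin.last N) ∧
      ∀ i, periodicCoord d i = periodicCoord c (i + 1) := by
  obtain ⟨h1, h2⟩ := mem_extendCode.1 hc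
  refine ⟨Fin.snoc (fun i : Fin N => c (i + Fin.ofNat N 1).castSucc) (c (Fin.last N)),
    mem_extendCode.2 ⟨?_, ?_⟩, by simp, fun i => ?_⟩
  · simpa using hC.rotate_mem h1 (Fin.ofNat N 1)
  · simp only [Fin.snoc_last, Fin.snoc_castSucc, h2]
    exact (Equiv.sum_comp (Equiv.addRight (Fin.ofNat N 1)) fun i : Fin N => c i.castSucc).symm
  · simp only [periodicCoord, Fin.snoc_castSucc]
    congr 2
    exact Fin.ext (by simp [Fin.val_add])

theorem IsCyclicCode.one_mem {F : Type*} [Field F] {N : ℕ} [NeZero N]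
    {C : Submodule F (Fin N → F)} (hC : IsCyclicCode C) {c : Fin N → F} (hc : c ∈ C)
    (hsum : ∑ i, c i = 1) : (1 : Fin N → F) ∈ C := by
  have h : ∑ a : Fin N, (fun i => c (i + a)) ∈ C :=
    Submodule.sum_mem _ fun a _ => hC.rotate_mem hc a
  convert h
  funext i
  rw [Finset.sum_apply, Pi.one_apply, ← hsum]
  exact (Equiv.sum_comp (Equiv.addLeft i) c).symm

/-- In a shift-invariant three-dimensional code, a word with last coordinate `0` is determined by
two consecutive coordinates. -/
theorem eq_zero_of_consecutive_zeros {F : Type*} [Field F] [DecidableEq F] {N : ℕ} [NeZero N]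
    {C : Submodule F (Fin (N + 1) → F)} (hdim : Module.finrank F C = 3)
    (hdual : ∀ c ∈ dualCode C, c ≠ 0 → 3 ≤ hammingNorm c)
    (hshift : ∀ c ∈ C, ∃ d ∈ C, d (Fin.last N) = c (Fin.last N) ∧
      ∀ i, periodicCoord d i = periodicCoord c (i + 1))
    {c : Fin (N + 1) → F} (hc : c ∈ C) (hlast : c (Fin.last N) = 0)
    (h0 : periodicCoord c 0 = 0) (h1 : periodicCoord c 1 = 0) : c = 0 := by
  by_contra hne
  have hfin := finrank_vanish_pair hdim hdual
    (Fin.castSucc_lt_last (Fin.ofNat N 0)).ne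
  set W := C ⊓ (LinearMap.ker (LinearMap.proj (Fin.ofNat N 0).castSucc :
      (Fin (N + 1) → F) →ₗ[F] F) ⊓
    LinearMap.ker (LinearMap.proj (Fin.last N) : (Fin (N + 1) → F) →ₗ[F] F)) with hW
  have hmem (d : Fin (N + 1) → F) :
      d ∈ W ↔ d ∈ C ∧ periodicCoord d 0 = 0 ∧ d (Fin.last N) = 0 := by
    simp [hW, periodicCoord]
  have hcW : c ∈ W := (hmem c).2 ⟨hc, h0, hlast⟩
  have hspan := (finrank_eq_one_iff_of_nonzero' (⟨c, hcW⟩ : W)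
    (fun h => hne (congrArg Subtype.val h))).1 hfin
  have hall : ∀ k, ∀ d ∈ W, periodicCoord d k = 0 := by
    intro k
    induction k with
    | zero => exact fun d hd => ((hmem d).1 hd).2.1
    | succ k ih =>
      intro d hd
      obtain ⟨e, heC, helast, he⟩ := hshift d ((hmem d).1 hd).1
      obtain ⟨a, ha⟩ := hspan ⟨d, hd⟩
      have had : d = a • c := (congrArg Subtype.val ha).symm
      have hd1 : periodicCoord d 1 = 0 := by
        rw [had]
        exact (congrArg (a * ·) h1).trans (mul_zero a)
      rw [← he]
      exact ih e ((hmem e).2 ⟨heC, (he 0).trans hd1, helast.trans ((hmem d).1 hd).2.2⟩)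
  exact hne (ext_periodicCoord hlast fun k => hall k c hcW)

/-- The words with last coordinate `0` of a shift-invariant three-dimensional code form the space
of all solutions of a linear recurrence of order two. -/
theorem exists_recurrence_basis {F : Type*} [Field F] [DecidableEq F] {N : ℕ} [NeZero N]
    {C : Submodule F (Fin (N + 1) → F)} (hdim : Module.finrank F C = 3)
    (hdual : ∀ c ∈ dualCode C, c ≠ 0 → 3 ≤ hammingNorm c)
    (hshift : ∀ c ∈ C, ∃ d ∈ C, d (Fin.last N) = c (Fin.last N) ∧
      ∀ i, periodicCoord d i = periodicCoord c (i + 1)) :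
    ∃ (x y : Fin (N + 1) → F) (p s : F), x ∈ C ∧ y ∈ C ∧ x (Fin.last N) = 0 ∧
      y (Fin.last N) = 0 ∧ periodicCoord x 0 = 1 ∧ periodicCoord y 0 = 0 ∧
      periodicCoord x 1 = 0 ∧ periodicCoord y 1 = 1 ∧
      (∀ c ∈ C, c (Fin.last N) = 0 → ∃ a b : F, c = a • x + b • y) ∧
      (∀ i, periodicCoord x (i + 1) = p * periodicCoord y i) ∧
      (∀ i, periodicCoord y (i + 1) = periodicCoord x i + s * periodicCoord y i) := by
  have hN : 2 ≤ N + 1 := by have := NeZero.pos N; omega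
  have hfin := finrank_vanish hN hdim hdual (Fin.last N)
  set W := C ⊓ LinearMap.ker (LinearMap.proj (Fin.last N) : (Fin (N + 1) → F) →ₗ[F] F) with hW
  have hmem (d : Fin (N + 1) → F) : d ∈ W ↔ d ∈ C ∧ d (Fin.last N) = 0 := by simp [hW]
  let e := evalPair W (Fin.ofNat N 0).castSucc (Fin.ofNat N 1).castSucc
  have he (d : W) : e d = (periodicCoord d.1 0, periodicCoord d.1 1) := rfl
  have hinj : Function.Injective e := by
    rw [← LinearMap.ker_eq_bot, LinearMap.ker_eq_bot']
    intro d hd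
    rw [he, Prod.mk_eq_zero] at hd
    obtain ⟨hdC, hdl⟩ := (hmem d.1).1 d.2
    exact Subtype.ext (eq_zero_of_consecutive_zeros hdim hdual hshift hdC hdl hd.1 hd.2)
  have hsurj : Function.Surjective e :=
    (LinearMap.injective_iff_surjective_of_finrank_eq_finrank (by simp [hfin])).1 hinj
  obtain ⟨⟨x, hxW⟩, hx⟩ := hsurj (1, 0)
  obtain ⟨⟨y, hyW⟩, hy⟩ := hsurj (0, 1)
  rw [he, Prod.mk.injEq] at hx hy
  dsimp only at hx hy
  obtain ⟨hxC, hxl⟩ := (hmem x).1 hxW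
  obtain ⟨hyC, hyl⟩ := (hmem y).1 hyW
  have hspan : ∀ c ∈ C, c (Fin.last N) = 0 →
      c = periodicCoord c 0 • x + periodicCoord c 1 • y := by
    intro c hc hcl
    have h : (⟨c, (hmem c).2 ⟨hc, hcl⟩⟩ : W) =
        periodicCoord c 0 • ⟨x, hxW⟩ + periodicCoord c 1 • ⟨y, hyW⟩ := by
      apply hinj
      rw [map_add, map_smul, map_smul, he, he, he]
      simp [hx, hy]
    exact congrArg Subtype.val h
  have hexp {c : Fin (N + 1) → F} (hc : c ∈ C) (hcl : c (Fin.last N) = 0) (i : ℕ) :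
      periodicCoord c (i + 1) =
        periodicCoord c 1 * periodicCoord x i + periodicCoord c 2 * periodicCoord y i := by
    obtain ⟨d, hd, hdl, hdi⟩ := hshift c hc
    have h := congrArg (periodicCoord · i) (hspan d hd (hdl.trans hcl))
    rwa [hdi, hdi, hdi] at h
  refine ⟨x, y, periodicCoord x 2, periodicCoord y 2, hxC, hyC, hxl, hyl, hx.1, hy.1, hx.2, hy.2,
    fun c hc hcl => ⟨_, _, hspan c hc hcl⟩, fun i => ?_, fun i => ?_⟩
  · rw [hexp hxC hxl, hx.2]; ring
  · rw [hexp hyC hyl, hy.2]; ring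

theorem existsUnique_algebraMap_add_smul_s7 {F K : Type*} [Field F] [Field K] [Algebra F K]
    (hK : Module.finrank F K = 2) {β : K} (hβ : ∀ b : F, algebraMap F K b ≠ β) (z : K) :
    ∃! p : F × F, z = algebraMap F K p.1 + p.2 • β := by
  have : Module.Finite F K := Module.finite_of_finrank_pos (by omega)
  let φ : F × F →ₗ[F] K := (Algebra.linearMap F K).coprod (LinearMap.toSpanSingleton F K β)
  have hφ (p : F × F) : φ p = algebraMap F K p.1 + p.2 • β := by simp [φ]
  have hinj : Function.Injective φ := by
    rw [← LinearMap.ker_eq_bot, LinearMap.ker_eq_bot']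
    rintro ⟨a, b⟩ h
    rw [hφ, Algebra.smul_def] at h
    dsimp only at h
    have hb : b = 0 := by
      by_contra hb
      have hb' : algebraMap F K b ≠ 0 := by simpa using hb
      refine hβ (-a / b) ?_
      rw [map_div₀, map_neg, div_eq_iff hb']
      linear_combination -h
    simpa [hb] using h
  have hbij : Function.Bijective φ :=
    ⟨hinj, (LinearMap.injective_iff_surjective_of_finrank_eq_finrank (by simp [hK])).1 hinj⟩
  obtain ⟨p, hp, hu⟩ := hbij.existsUnique z
  exact ⟨p, hp.symm.trans (hφ p), fun p' hp' => hu p' ((hφ p').trans hp'.symm)⟩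

/-- The constant word `1` belongs to an extended cyclic code in characteristic two, provided some
word has a nonzero last coordinate and each nonzero word that vanishes at the last coordinate
vanishes at another one as well. -/
theorem one_mem_extendCode {F : Type*} [Field F] [CharP F 2] {N : ℕ} [NeZero N]
    {C : Submodule F (Fin N → F)} (hC : IsCyclicCode C)
    (hlast : ∃ c ∈ extendCode C, c (Fin.last N) = 1)
    (hzero : ∀ c ∈ extendCode C, c ≠ 0 → c (Fin.last N) = 0 → ∃ i : Fin N, c i.castSucc = 0) :
    (fun _ => 1) ∈ extendCode C := by
  obtain ⟨c, hc, hcl⟩ := hlast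
  obtain ⟨h1, h2⟩ := mem_extendCode.1 hc
  have hone := hC.one_mem h1 (h2.symm.trans hcl)
  have hmem : (Fin.snoc (α := fun _ => F) (fun _ : Fin N => 1) (N : F)) ∈ extendCode C :=
    mem_extendCode.2 ⟨by simpa [← Pi.one_def] using hone, by simp⟩
  rcases N.even_or_odd with hev | hodd
  · have hN0 : (N : F) = 0 := (CharP.cast_eq_zero_iff F 2 N).2 hev.two_dvd
    rw [hN0] at hmem
    obtain ⟨i, hi⟩ := hzero _ hmem
      (fun h => by simpa using congrFun h (Fin.ofNat N 0).castSucc) (by simp)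
    simp at hi
  · have hN1 : (N : F) = 1 := by
      obtain ⟨k, rfl⟩ := hodd
      push_cast
      rw [CharTwo.two_eq_zero, zero_mul, zero_add]
    rw [hN1] at hmem
    convert hmem using 1
    funext i
    refine Fin.lastCases ?_ (fun j => ?_) i <;> simp

/-- **Lemma (extended cyclic `[N+1, 3, N+1−t]` codes with `d⊥ ≥ 3` come from cyclic
Denniston maximal arcs).**  Let `q = 2^m`, `1 < t < q`, `N = (q+1)(t−1)`,
`F = 𝔽_q ⊆ K = 𝔽_{q²}`.  If `C` is an extended cyclic code over `F` with parameters
`[N+1, 3, N+1−t]` whose dual distance is at least `3`, then `N ∣ q²−1` and there are a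
generator `γ` of `S' = {x ∈ K : x^N = 1}` and an `F`-basis `{1, ξ}` of `K` such that,
writing `γ^{−i} = x_i + y_i ξ`, the code `C` is the row space of the `3 × (N+1)` matrix
with columns `(x_i, y_i, 1)`, `0 ≤ i ≤ N−1`, and `(0, 0, 1)`; moreover
`{x ∈ K : x^N = 1} ∪ {0}` is a cyclic Denniston maximal arc: a set of `N+1` affine points
of `AG(2,q) = K` meeting every affine line in exactly `0` or `t` points. -/
theorem extended_cyclic_code_dual_dist_ge_three_gives_denniston_arc
    (m q t N : ℕ) (hm : 1 ≤ m) (hq : q = 2 ^ m) (ht1 : 1 < t) (ht2 : t < q)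
    (hN : N = (q + 1) * (t - 1))
    (F K : Type*) [Field F] [Fintype F] [DecidableEq F] [Field K] [Fintype K] [Algebra F K]
    (hF : Fintype.card F = q) (hK : Fintype.card K = q ^ 2)
    (C : Submodule F (Fin (N + 1) → F))
    (hext : ∃ C' : Submodule F (Fin N → F), IsCyclicCode C' ∧ C = extendCode C')
    (hdim : Module.finrank F ↥C = 3)
    (hdist : (∀ c ∈ C, c ≠ 0 → N + 1 - t ≤ hammingNorm c) ∧
      ∃ c ∈ C, c ≠ 0 ∧ hammingNorm c = N + 1 - t)
    (hdual : ∀ c ∈ dualCode C, c ≠ 0 → 3 ≤ hammingNorm c) :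
    N ∣ q ^ 2 - 1 ∧
    ∃ (γ ξ : K) (x y : Fin N → F),
      orderOf γ = N ∧
      (∀ z : K, ∃! p : F × F, z = algebraMap F K p.1 + p.2 • ξ) ∧
      (∀ i : Fin N, algebraMap F K (x i) + y i • ξ = γ⁻¹ ^ (i : ℕ)) ∧
      C = Submodule.span F {Fin.snoc x 0, Fin.snoc y 0, fun _ => 1} ∧
      (Set.range fun i : Fin N => γ⁻¹ ^ (i : ℕ)) ∪ {0} = {z : K | z ^ N = 1} ∪ {0} ∧
      Set.ncard ({z : K | z ^ N = 1} ∪ {0}) = N + 1 ∧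
      (∀ a b : K, b ≠ 0 →
        (({z : K | z ^ N = 1} ∪ {0}) ∩ {z : K | ∃ c : F, z = a + c • b}).ncard = 0 ∨
        (({z : K | z ^ N = 1} ∪ {0}) ∩ {z : K | ∃ c : F, z = a + c • b}).ncard = t) := by
  classical
  have hq2 : 2 ≤ q := by omega
  have hN2 : 2 ≤ N := by
    obtain ⟨r, rfl⟩ : ∃ r, t = r + 2 := ⟨t - 2, by omega⟩
    rw [hN, show r + 2 - 1 = r + 1 by omega]
    nlinarith
  have : NeZero N := ⟨by omega⟩
  have : CharP F 2 := by
    refine CharTwo.of_one_ne_zero_of_two_eq_zero one_ne_zero ?_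
    have h := FiniteField.cast_card_eq_zero F
    rw [hF, hq, Nat.cast_pow] at h
    exact_mod_cast eq_zero_of_pow_eq_zero h
  have hfinK : Module.finrank F K = 2 := by
    have h := Module.card_eq_pow_finrank (K := F) (V := K)
    rw [hF, hK] at h
    exact (Nat.pow_right_injective hq2 h).symm
  obtain ⟨C', hcyc, hCC⟩ := hext
  have hzeros : ∀ c ∈ C, c ≠ 0 → ∀ j, c j = 0 →
      (Finset.univ.filter fun i => c i = 0).card = t := fun c hc hc0 j hj =>
    card_zeros_eq ht1 (by rw [hN]) hF hdim hdist.1 hdual hc hc0 hj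
  have hzero : ∀ c ∈ C, c ≠ 0 → c (Fin.last N) = 0 → ∃ i : Fin N, c i.castSucc = 0 := by
    intro c hc hc0 hcl
    obtain ⟨k, hk, hkl⟩ := Finset.exists_mem_ne
      (by rw [hzeros c hc hc0 _ hcl]; exact ht1) (Fin.last N)
    obtain ⟨i, rfl⟩ := Fin.exists_castSucc_eq.2 hkl
    exact ⟨i, (Finset.mem_filter.1 hk).2⟩
  have hsep {i j : Fin (N + 1)} (hij : i ≠ j) : ∃ c ∈ C, c i = 0 ∧ c j = 1 := by
    obtain ⟨c, hc⟩ := LinearMap.range_eq_top.1 (evalPair_range hdual hij) (0, 1)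
    rw [evalPair_apply, Prod.mk.injEq] at hc
    exact ⟨c.1, c.2, hc⟩
  have hone : (fun _ => 1) ∈ C := by
    subst hCC
    obtain ⟨c, hc, -, hcl⟩ := hsep (Fin.castSucc_lt_last (Fin.ofNat N 0)).ne
    exact one_mem_extendCode hcyc ⟨c, hc, hcl⟩ hzero
  obtain ⟨X, Y, p, s, hXC, hYC, hXl, hYl, hX0, hY0, hX1, hY1, hspan, hXr, hYr⟩ :=
    exists_recurrence_basis hdim hdual
      (by subst hCC; exact fun c => exists_shift_of_isCyclicCode hcyc)
  have hroot (b : F) : b ^ 2 ≠ p + s * b := by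
    intro hb
    have hper (i : ℕ) : periodicCoord (X + b • Y) i = periodicCoord X i + b * periodicCoord Y i :=
      rfl
    have hw (i : ℕ) : periodicCoord (X + b • Y) i = b ^ i := by
      induction i with
      | zero => rw [hper, hX0, hY0]; ring
      | succ i ih =>
        rw [pow_succ, ← ih, hper, hper, hXr, hYr]
        linear_combination -(periodicCoord Y i) * hb
    have hbN : b ^ N = 1 := by rw [← hw, periodicCoord_self, hw, pow_zero]
    have hne : X + b • Y ≠ 0 := by
      intro h
      have h0 := hw 0
      rw [h, pow_zero] at h0
      exact zero_ne_one h0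
    obtain ⟨i, hi⟩ := hzero _ (C.add_mem hXC (C.smul_mem b hYC)) hne (by simp [hXl, hYl])
    rw [← periodicCoord_val (X + b • Y), hw] at hi
    rw [eq_zero_of_pow_eq_zero hi, zero_pow (by omega)] at hbN
    exact zero_ne_one hbN
  obtain ⟨β, hβ⟩ := exists_sq_eq_of_no_root (K := K) (hfinK ▸ dvd_rfl) p s hroot
  rw [Algebra.smul_def] at hβ
  have hβF (b : F) : algebraMap F K b ≠ β := by
    rintro rfl
    refine hroot b ((algebraMap F K).injective ?_)
    simpa using hβ
  have hbasis := existsUnique_algebraMap_add_smul_s7 hfinK hβF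
  have hcoord {a b a' b' : F}
      (h : algebraMap F K a + b • β = algebraMap F K a' + b' • β) : a = a' ∧ b = b' :=
    Prod.mk.inj ((hbasis _).unique (y₁ := (a, b)) (y₂ := (a', b')) rfl h)
  have hpow (i : ℕ) : algebraMap F K (periodicCoord X i) + periodicCoord Y i • β = β ^ i := by
    induction i with
    | zero => simp [hX0, hY0]
    | succ i ih =>
      rw [pow_succ, ← ih, hXr, hYr]
      simp only [Algebra.smul_def, map_mul, map_add]
      linear_combination -(algebraMap F K (periodicCoord Y i)) * hβ
  have hdecomp : ∀ c ∈ C, ∃ a b : F, c = a • X + b • Y + c (Fin.last N) • fun _ => 1 := by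
    intro c hc
    obtain ⟨a, b, hab⟩ := hspan (c - c (Fin.last N) • fun _ => 1)
      (C.sub_mem hc (C.smul_mem _ hone)) (by simp)
    exact ⟨a, b, by rw [← hab, sub_add_cancel]⟩
  set P : Fin (N + 1) → K := fun j => algebraMap F K (X j) + Y j • β with hP
  have hPcast (i : Fin N) : P i.castSucc = β ^ (i : ℕ) := by
    rw [← hpow, periodicCoord_val, periodicCoord_val]
  have hPlast : P (Fin.last N) = 0 := by simp [hP, hXl, hYl]
  have hPinj : Function.Injective P := by
    intro i j hij
    by_contra hne
    obtain ⟨hx, hy⟩ := hcoord hij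
    obtain ⟨c, hc, hci, hcj⟩ := hsep hne
    obtain ⟨a, b, hab⟩ := hdecomp c hc
    have hi := congrFun hab i
    have hj := congrFun hab j
    simp only [Pi.add_apply, Pi.smul_apply] at hi hj
    rw [hx, hy, ← hj, hci, hcj] at hi
    exact zero_ne_one hi
  have hβN : β ^ N = 1 := by
    rw [← hpow, periodicCoord_self, periodicCoord_self, hpow, pow_zero]
  have hord : orderOf β = N := by
    rw [orderOf_eq_iff (by omega)]
    refine ⟨hβN, fun k hk hk0 h => ?_⟩
    have h' : P (Fin.castSucc ⟨k, hk⟩) = P (Fin.castSucc ⟨0, by omega⟩) := by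
      rw [hPcast, hPcast, h, pow_zero]
    have := congrArg Fin.val (hPinj h')
    simp at this
    omega
  have hβ0 : β ≠ 0 := by simpa using (hβF 0).symm
  have hroots : (Set.range fun i : Fin N => β ^ (i : ℕ)) = {z : K | z ^ N = 1} := by
    ext z
    constructor
    · rintro ⟨i, rfl⟩
      change (β ^ (i : ℕ)) ^ N = 1
      rw [pow_right_comm, hβN, one_pow]
    · intro hz
      have hprim : IsPrimitiveRoot β N := hord ▸ IsPrimitiveRoot.orderOf β
      obtain ⟨i, hi, rfl⟩ := hprim.eq_pow_of_pow_eq_one hz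
      exact ⟨⟨i, hi⟩, rfl⟩
  have hPrange : {z : K | z ^ N = 1} ∪ {0} = Set.range P := by
    rw [← hroots]
    ext z
    constructor
    · rintro (⟨i, rfl⟩ | rfl)
      · exact ⟨_, hPcast i⟩
      · exact ⟨_, hPlast⟩
    · rintro ⟨i, rfl⟩
      refine Fin.lastCases ?_ (fun j => ?_) i
      · exact Or.inr hPlast
      · exact Or.inl ⟨j, (hPcast j).symm⟩
  refine ⟨?_, β⁻¹, β, fun i => X i.castSucc, fun i => Y i.castSucc, ?_, hbasis, ?_, ?_, ?_, ?_, ?_⟩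
  · rw [← hord, ← hK]
    exact orderOf_dvd_of_pow_eq_one (FiniteField.pow_card_sub_one_eq_one β hβ0)
  · rw [← hord, orderOf_eq_orderOf_iff]
    simp
  · intro i
    rw [inv_inv]
    exact hPcast i
  · have hX : (Fin.snoc (fun i : Fin N => X i.castSucc) 0 : Fin (N + 1) → F) = X := by
      rw [← hXl]; exact Fin.snoc_init_self X
    have hY : (Fin.snoc (fun i : Fin N => Y i.castSucc) 0 : Fin (N + 1) → F) = Y := by
      rw [← hYl]; exact Fin.snoc_init_self Y
    rw [hX, hY]
    refine le_antisymm (fun c hc => ?_) (Submodule.span_le.2 ?_)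
    · obtain ⟨a, b, hab⟩ := hdecomp c hc
      rw [Submodule.mem_span_triple]
      exact ⟨a, b, _, hab.symm⟩
    · rintro _ (rfl | rfl | rfl) <;> assumption
  · rw [inv_inv, hroots]
  · rw [hPrange, ← Set.image_univ, Set.ncard_image_of_injective _ hPinj, Set.ncard_univ,
      Nat.card_eq_fintype_card, Fintype.card_fin]
  · intro a b hb
    obtain ⟨⟨a₁, a₂⟩, rfl, -⟩ := hbasis a
    obtain ⟨⟨b₁, b₂⟩, rfl, -⟩ := hbasis b
    dsimp only at hb ⊢
    set w : Fin (N + 1) → F := b₂ • X + (-b₁) • Y + (b₁ * a₂ - b₂ * a₁) • fun _ => 1 with hw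
    have hwC : w ∈ C := C.add_mem (C.add_mem (C.smul_mem _ hXC) (C.smul_mem _ hYC))
      (C.smul_mem _ hone)
    have hwi (i : Fin (N + 1)) : w i = b₂ * X i - b₁ * Y i + (b₁ * a₂ - b₂ * a₁) := by
      simp [hw, sub_eq_add_neg]
    have hw0 : w ≠ 0 := by
      intro h
      have hl := congrFun h (Fin.last N)
      have h0 := congrFun h (Fin.ofNat N 0).castSucc
      have h1 := congrFun h (Fin.ofNat N 1).castSucc
      rw [hwi, Pi.zero_apply] at hl h0 h1
      rw [hXl, hYl] at hl
      rw [show X (Fin.ofNat N 0).castSucc = 1 from hX0,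
        show Y (Fin.ofNat N 0).castSucc = 0 from hY0] at h0
      rw [show X (Fin.ofNat N 1).castSucc = 0 from hX1,
        show Y (Fin.ofNat N 1).castSucc = 1 from hY1] at h1
      apply hb
      rw [show b₂ = 0 by linear_combination h0 - hl, show b₁ = 0 by linear_combination hl - h1]
      simp
    have hline (i : Fin (N + 1)) : w i = 0 ↔ ∃ c : F, P i =
        algebraMap F K a₁ + a₂ • β + c • (algebraMap F K b₁ + b₂ • β) := by
      have hcomb (c : F) : algebraMap F K a₁ + a₂ • β + c • (algebraMap F K b₁ + b₂ • β) =
          algebraMap F K (a₁ + c * b₁) + (a₂ + c * b₂) • β := by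
        simp only [Algebra.smul_def, map_mul, map_add]; ring
      simp only [hcomb, hwi]
      constructor
      · intro h
        by_cases hb₁ : b₁ = 0
        · subst hb₁
          have hb₂ : b₂ ≠ 0 := by rintro rfl; simp at hb
          refine ⟨(Y i - a₂) / b₂, ?_⟩
          have hXi : X i = a₁ := mul_left_cancel₀ hb₂ (by linear_combination h)
          rw [div_mul_cancel₀ _ hb₂]
          simp [hP, hXi]
        · refine ⟨(X i - a₁) / b₁, ?_⟩
          have hYi : a₂ + (X i - a₁) / b₁ * b₂ = Y i := by
            field_simp
            linear_combination h
          rw [hYi, div_mul_cancel₀ _ hb₁]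
          simp [hP]
      · rintro ⟨c, hc⟩
        obtain ⟨h1, h2⟩ := hcoord hc
        rw [h1, h2]; ring
    have hset : ({z : K | z ^ N = 1} ∪ {0}) ∩ {z : K | ∃ c : F, z =
        algebraMap F K a₁ + a₂ • β + c • (algebraMap F K b₁ + b₂ • β)} =
        P '' ↑(Finset.univ.filter fun i => w i = 0) := by
      rw [hPrange]
      ext z
      constructor
      · rintro ⟨⟨i, rfl⟩, hi⟩
        exact ⟨i, by simpa using (hline i).2 hi, rfl⟩
      · rintro ⟨i, hi, rfl⟩
        exact ⟨⟨i, rfl⟩, (hline i).1 (by simpa using hi)⟩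
    rw [hset, Set.ncard_image_of_injective _ hPinj, Set.ncard_coe_finset]
    by_cases hex : ∃ j, w j = 0
    · obtain ⟨j, hj⟩ := hex
      exact Or.inr (hzeros w hwC hw0 j hj)
    · refine Or.inl (Finset.card_eq_zero.2 (Finset.filter_eq_empty_iff.2 fun i _ hi => ?_))
      exact hex ⟨i, hi⟩
end

section
/- Let q = 2^m and F = 𝔽_q ⊆ K = 𝔽_{q²} ⊆ E = 𝔽_{q⁴}. Then {x ∈ E : Tr_{K/F}(x^{q²+1}) = 0} = {λu : λ ∈ F, u ∈ E, u^{q²+1} = 1}; that is, the singular vectors of the quadratic form Q(x) = Tr_{K/F}(x^{q²+1}) are exactly the F-scalar multiples of elements of the set O = {u ∈ E : u^{q²+1} = 1}. -/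
open Polynomial in
theorem mem_range_algebraMap_of_pow_card_eq_self {F E : Type*} [Field F] [Fintype F] [Field E]
    [Algebra F E] {b : E} (hb : b ^ Fintype.card F = b) : b ∈ (algebraMap F E).range := by
  have hsplit : (X ^ Fintype.card F - X : F[X]).Splits :=
    splits_iff_card_roots.2 (by
      rw [FiniteField.roots_X_pow_card_sub_X,
        FiniteField.X_pow_card_sub_X_natDegree_eq F Fintype.one_lt_card]
      simp)
  exact hsplit.mem_range_of_isRoot (FiniteField.X_pow_card_sub_X_ne_zero F Fintype.one_lt_card)
    (by simp [hb])

/-- **Singular vectors of `Q(x) = Tr_{K/F}(x^{q²+1})`.**  Let `q = 2^m` and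
`F = 𝔽_q ⊆ K = 𝔽_{q²} ⊆ E = 𝔽_{q⁴}`.  The singular vectors of the quadratic form
`Q(x) = Tr_{K/F}(x^{q²+1}) = x^{q²+1} + (x^{q²+1})^q` are exactly the `F`-scalar
multiples of elements of `O = {u ∈ E : u^{q²+1} = 1}`. -/
theorem singular_vectors_eq_scalar_multiples_of_unit_circle
    (m q : ℕ) (hm : 1 ≤ m) (hq : q = 2 ^ m)
    (F E : Type*) [Field F] [Fintype F] [Field E] [Fintype E] [Algebra F E]
    (hF : Fintype.card F = q) (hE : Fintype.card E = q ^ 4) :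
    {x : E | x ^ (q ^ 2 + 1) + (x ^ (q ^ 2 + 1)) ^ q = 0} =
    {z : E | ∃ (l : F) (u : E), u ^ (q ^ 2 + 1) = 1 ∧ z = l • u} := by
  have h_two : (2 : E) = 0 := by
    have h := Nat.cast_card_eq_zero E
    rw [hE, hq] at h
    push_cast at h
    exact eq_zero_of_pow_eq_zero (eq_zero_of_pow_eq_zero h)
  have h_add (a : E) : a + a = 0 := by rw [← two_mul, h_two, zero_mul]
  have h_fix (l : F) : algebraMap F E l ^ q = algebraMap F E l := by
    rw [← map_pow, ← hF, FiniteField.pow_card]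
  have h_norm (l : F) : algebraMap F E l ^ (q ^ 2 + 1) = algebraMap F E l ^ 2 := by
    rw [pow_succ, pow_two q, pow_mul, h_fix, h_fix, ← pow_two]
  ext x
  simp only [Set.mem_ofPred_eq]
  constructor
  · intro hx
    rcases eq_or_ne x 0 with rfl | hx0
    · exact ⟨0, 1, one_pow _, by simp⟩
    have hN : (x ^ (q ^ 2 + 1)) ^ q = x ^ (q ^ 2 + 1) :=
      add_left_cancel (hx.trans (h_add _).symm)
    obtain ⟨a, ha⟩ := mem_range_algebraMap_of_pow_card_eq_self (F := F) (by rwa [hF] :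
      (x ^ (q ^ 2 + 1)) ^ Fintype.card F = x ^ (q ^ 2 + 1))
    obtain ⟨b, hb⟩ : ∃ b : F, b ^ 2 = a := by
      refine ⟨a ^ 2 ^ (m - 1), ?_⟩
      rw [← pow_mul, ← pow_succ, Nat.sub_add_cancel hm, ← hq, ← hF, FiniteField.pow_card]
    have hb0 : algebraMap F E b ≠ 0 := by
      intro h
      apply pow_ne_zero (q ^ 2 + 1) hx0
      rw [← ha, ← hb, map_pow, h, zero_pow two_ne_zero]
    refine ⟨b, x / algebraMap F E b, ?_, ?_⟩
    · rw [div_pow, h_norm, ← map_pow, hb, ha, div_self (pow_ne_zero _ hx0)]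
    · rw [Algebra.smul_def, mul_div_cancel₀ _ hb0]
  · rintro ⟨l, u, hu, rfl⟩
    rw [Algebra.smul_def, mul_pow, hu, mul_one, h_norm, pow_right_comm, h_fix, h_add]
end

section
/- Let q = 2^m, F = 𝔽_q, E = 𝔽_{q⁴}, and O = {u ∈ E : u^{q²+1} = 1}. Then |O| = q² + 1, distinct elements of O are not F-proportional (if u, v ∈ O and v = λu with λ ∈ F, then u = v), and any three pairwise distinct elements of O are linearly independent over F. Consequently O determines a set of q²+1 points of PG(3, q) = P(E), no three of which are collinear (an ovoid). -/
/-- In a finite field, a divisor `n` of `|E| - 1` is the number of `n`-th roots of unity. -/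
theorem FiniteField.ncard_pow_eq_one {E : Type*} [Field E] [Fintype E] {n : ℕ}
    (hn : n ∣ Fintype.card E - 1) : Set.ncard {u : E | u ^ n = 1} = n := by
  classical
  obtain ⟨k, hk⟩ := hn
  have hpos : 0 < Fintype.card E - 1 := Nat.sub_pos_of_lt Fintype.one_lt_card
  have hn0 : 0 < n := Nat.pos_of_ne_zero (by rintro rfl; simp at hk; omega)
  obtain ⟨g, hg⟩ := IsCyclic.exists_generator (α := Eˣ)
  have hord : orderOf g = Fintype.card E - 1 := by
    rw [orderOf_eq_card_of_forall_mem_zpowers hg, Nat.card_eq_fintype_card, Fintype.card_units]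
  have hprim : IsPrimitiveRoot (g : E) (Fintype.card E - 1) :=
    IsPrimitiveRoot.coe_units_iff.2 (hord ▸ IsPrimitiveRoot.orderOf g)
  have hζ : IsPrimitiveRoot ((g : E) ^ k) n := hprim.pow hpos (by rw [hk, mul_comm])
  have hset : {u : E | u ^ n = 1} = Polynomial.nthRootsFinset n (1 : E) := by
    ext u
    simp [Polynomial.mem_nthRootsFinset hn0]
  rw [hset, Set.ncard_coe_finset, hζ.card_nthRootsFinset]

/-- A `(q²+1)`-st root of unity whose trace `t + t⁻¹` is fixed by the `q`-Frobenius is trivial. -/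
theorem eq_one_of_add_inv_pow_eq {E : Type*} [Field E] [CharP E 2] {m q : ℕ} (hq : q = 2 ^ m)
    {t : E} (ht : t ^ (q ^ 2 + 1) = 1) (hs : (t + t⁻¹) ^ q = t + t⁻¹) : t = 1 := by
  have ht0 : t ≠ 0 := by rintro rfl; simp at ht
  have hT0 : t ^ q ≠ 0 := pow_ne_zero q ht0
  have hsum : t ^ q + (t ^ q)⁻¹ = t + t⁻¹ := by
    rw [← hs, ← inv_pow, hq, add_pow_char_pow]
  have hfac : (t ^ q - t) * (t ^ q * t - 1) = 0 := by
    field_simp at hsum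
    linear_combination hsum
  have hfix : t ^ q ^ 2 = t := by
    rw [pow_two, pow_mul]
    rcases mul_eq_zero.1 hfac with h | h
    · rw [sub_eq_zero.1 h, sub_eq_zero.1 h]
    · rw [eq_inv_of_mul_eq_one_left (sub_eq_zero.1 h), inv_pow,
        eq_inv_of_mul_eq_one_left (sub_eq_zero.1 h), inv_inv]
  rw [pow_succ, hfix, ← pow_two] at ht
  exact frobenius_inj E 2 (by simpa [frobenius_def] using ht)

/-- A linear relation between three `(q²+1)`-st roots of unity, the first two distinct, has a
vanishing coefficient among the first two. -/
theorem mul_eq_zero_of_smul_add_smul_add_smul_eq_zero {F E : Type*} [Field F] [Fintype F] [Field E]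
    [Algebra F E] [CharP E 2] {m q : ℕ} (hq : q = 2 ^ m) (hF : Fintype.card F = q) {u v w : E}
    (hu : u ^ (q ^ 2 + 1) = 1) (hv : v ^ (q ^ 2 + 1) = 1) (hw : w ^ (q ^ 2 + 1) = 1)
    (huv : u ≠ v) {a b c : F} (h : a • u + b • v + c • w = 0) : a * b = 0 := by
  by_contra hab
  have hu0 : u ≠ 0 := by rintro rfl; simp at hu
  have hv0 : v ≠ 0 := by rintro rfl; simp at hv
  have hfrob (x : F) : algebraMap F E x ^ q = algebraMap F E x := by
    rw [← map_pow, ← hF, FiniteField.pow_card]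
  have hfrob₂ (x : F) : algebraMap F E x ^ q ^ 2 = algebraMap F E x := by
    rw [pow_two, pow_mul, hfrob, hfrob]
  have hconj : a • u ^ q ^ 2 + b • v ^ q ^ 2 + c • w ^ q ^ 2 = 0 := by
    have h' := congrArg (· ^ q ^ 2) h
    have hq2 : q ^ 2 = 2 ^ (m * 2) := by rw [hq, pow_mul]
    have hadd (x y : E) : (x + y) ^ q ^ 2 = x ^ q ^ 2 + y ^ q ^ 2 := by
      rw [hq2, add_pow_char_pow]
    have hq0 : q ^ 2 ≠ 0 := by rw [hq2]; positivity
    simpa only [hadd, Algebra.smul_def, mul_pow, hfrob₂, zero_pow hq0] using h'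
  have hu' := hu
  have hv' := hv
  rw [pow_succ] at hu hv hw
  have htrace : u * v⁻¹ + (u * v⁻¹)⁻¹ = algebraMap F E ((c ^ 2 - a ^ 2 - b ^ 2) / (a * b)) := by
    have habE : algebraMap F E a * algebraMap F E b ≠ 0 := by
      rw [← map_mul]; simpa using hab
    rw [eq_inv_of_mul_eq_one_left hu, eq_inv_of_mul_eq_one_left hv] at hconj
    simp only [Algebra.smul_def] at h hconj
    have hw' : algebraMap F E c * w ^ q ^ 2 =
        -(algebraMap F E a * u⁻¹ + algebraMap F E b * v⁻¹) := by
      linear_combination hconj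
    have hw'' : algebraMap F E c * w = -(algebraMap F E a * u + algebraMap F E b * v) := by
      linear_combination h
    have hc : algebraMap F E c ^ 2 = (algebraMap F E a * u⁻¹ + algebraMap F E b * v⁻¹) *
        (algebraMap F E a * u + algebraMap F E b * v) := by
      rw [← neg_mul_neg, ← hw', ← hw'']
      linear_combination -algebraMap F E c ^ 2 * hw
    simp only [map_div₀, map_sub, map_mul, map_pow]
    rw [eq_div_iff habE, hc]
    field_simp
    ring
  have hone : u * v⁻¹ = 1 := eq_one_of_add_inv_pow_eq hq
    (by rw [mul_pow, inv_pow, hu', hv', inv_one, one_mul]) (by rw [htrace, hfrob])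
  exact huv ((mul_inv_eq_one₀ hv0).1 hone)

/-- **`O = {u ∈ E : u^{q²+1} = 1}` determines an ovoid of `PG(3,q)`.**  Let `q = 2^m`,
`F = 𝔽_q ⊆ E = 𝔽_{q⁴}`.  Then `|O| = q²+1`, distinct elements of `O` are not
`F`-proportional, and any three pairwise distinct elements of `O` are `F`-linearly
independent; hence `O` gives `q²+1` points of `PG(3,q) = P(E)`, no three collinear. -/
theorem roots_of_unity_give_ovoid
    (m q : ℕ) (hm : 1 ≤ m) (hq : q = 2 ^ m)
    (F E : Type*) [Field F] [Fintype F] [Field E] [Fintype E] [Algebra F E]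
    (hF : Fintype.card F = q) (hE : Fintype.card E = q ^ 4) :
    Set.ncard {u : E | u ^ (q ^ 2 + 1) = 1} = q ^ 2 + 1 ∧
    (∀ u v : E, u ^ (q ^ 2 + 1) = 1 → v ^ (q ^ 2 + 1) = 1 →
      (∃ l : F, v = l • u) → u = v) ∧
    (∀ u v w : E, u ^ (q ^ 2 + 1) = 1 → v ^ (q ^ 2 + 1) = 1 → w ^ (q ^ 2 + 1) = 1 →
      u ≠ v → u ≠ w → v ≠ w →
      ∀ a b c : F, a • u + b • v + c • w = 0 → a = 0 ∧ b = 0 ∧ c = 0) := by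
  have : Fact (Nat.Prime 2) := ⟨Nat.prime_two⟩
  have : CharP E 2 := charP_of_card_eq_prime_pow (f := m * 4)
    (by rw [hE, hq, pow_mul])
  have hindep (u v w : E) (hu : u ^ (q ^ 2 + 1) = 1) (hv : v ^ (q ^ 2 + 1) = 1)
      (hw : w ^ (q ^ 2 + 1) = 1) (huv : u ≠ v) (a b c : F) (h : a • u + b • v + c • w = 0) :
      a * b = 0 := mul_eq_zero_of_smul_add_smul_add_smul_eq_zero hq hF hu hv hw huv h
  have hne {u : E} (hu : u ^ (q ^ 2 + 1) = 1) : u ≠ 0 := by rintro rfl; simp at hu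
  refine ⟨?_, ?_, ?_⟩
  · refine FiniteField.ncard_pow_eq_one ⟨q ^ 2 - 1, ?_⟩
    rw [hE, ← Nat.sq_sub_sq, one_pow, ← pow_mul]
  · rintro u v hu hv ⟨l, rfl⟩
    by_contra huv
    have hl : l = 0 := by
      simpa using hindep u (l • u) u hu hv hu huv l (-1) 0 (by simp)
    exact hne hv (by simp [hl])
  · intro u v w hu hv hw huv huw hvw a b c h
    have hab := hindep u v w hu hv hw huv a b c h
    have hac := hindep u w v hu hw hv huw a c b (by rw [← h]; abel)
    have hbc := hindep v w u hv hw hu hvw b c a (by rw [← h]; abel)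
    rcases mul_eq_zero.1 hab with rfl | rfl <;> rcases mul_eq_zero.1 hac with h1 | rfl <;>
      rcases mul_eq_zero.1 hbc with h2 | h2 <;> simp_all [hne hu, hne hv, hne hw]
end

section
/- Let q = 2^m, F = 𝔽_q, E = 𝔽_{q⁴}, and let C be a cyclic code over F with parameters [q²+1, 4, q²−q]. Then C is an ovoid code obtained from an elliptic quadric: there exist a generator γ of the cyclic group O = {u ∈ E : u^{q²+1} = 1} (so γ has multiplicative order q²+1) and an F-basis {1, ξ, ζ, η} of E such that, writing γ^{−i} = x_i + y_i ξ + z_i ζ + w_i η with x_i, y_i, z_i, w_i ∈ F for 0 ≤ i ≤ q², the code C equals the row space of the 4×(q²+1) matrix whose i-th column is (x_i, y_i, z_i, w_i); the columns, viewed as points of PG(3, q) = P(E), are pairwise distinct and form the elliptic quadric determined by O, i.e. the zero set in P(E) of the quadratic form Q(x) = Tr_{𝔽_{q²}/F}(x^{q²+1}), which is an ovoid of PG(3, q). -/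
open Polynomial IntermediateField

theorem eq_one_of_pow_eq_self {M : Type*} [Monoid M] {n : ℕ} (hn : Even n) {x : M}
    (h1 : x ^ (n + 1) = 1) (hx : x ^ n = x) : x = 1 := by
  obtain ⟨k, rfl⟩ := hn
  rw [pow_succ, hx, ← sq] at h1
  rw [← hx, ← two_mul, pow_mul, h1, one_pow]

theorem algebraMap_pow_card {F : Type*} (E : Type*) [Field F] [Fintype F] [Field E] [Algebra F E]
    (a : F) : algebraMap F E a ^ Fintype.card F = algebraMap F E a := by
  rw [← map_pow, FiniteField.pow_card]

theorem exists_algebraMap_eq_of_pow_card {F E : Type*} [Field F] [Fintype F] [Field E]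
    [Algebra F E] {x : E} (hx : x ^ Fintype.card F = x) : ∃ a : F, algebraMap F E a = x := by
  have h : Splits (X ^ Fintype.card F - X : F[X]) := by
    rw [splits_iff_card_roots, FiniteField.roots_X_pow_card_sub_X,
      FiniteField.X_pow_card_sub_X_natDegree_eq F Fintype.one_lt_card]
    rfl
  exact h.mem_range_of_isRoot (FiniteField.X_pow_card_sub_X_ne_zero F Fintype.one_lt_card)
    (by simp [hx])

/-- Counting a predicate of period `k` over `r` periods. -/
theorem Nat.count_mul_of_periodic (p : ℕ → Prop) [DecidablePred p] (k r : ℕ)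
    (hp : ∀ i, p (i + k) ↔ p i) : Nat.count p (k * r) = r * Nat.count p k := by
  induction r with
  | zero => simp
  | succ r ih =>
    rw [mul_add, mul_one, Nat.count_add', add_mul, one_mul, ← ih]
    simp_rw [hp]

theorem hammingNorm_eq_count {F : Type*} [Zero F] [DecidableEq F] {n : ℕ} (g : ℕ → F) :
    hammingNorm (fun i : Fin n => g i) = Nat.count (fun i => g i ≠ 0) n := by
  rw [hammingNorm, Nat.count_eq_card_filter_range, Finset.card_filter,
    Finset.card_filter, Finset.sum_range]

section

variable {F E : Type*} [Field F] [Field E] [Algebra F E]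

theorem finrank_eq_four_of_card_eq_pow [Fintype F] [Fintype E] (hE : Fintype.card E = Fintype.card F ^ 4) :
    Module.finrank F E = 4 := by
  have := Module.card_eq_pow_finrank (K := F) (V := E)
  rw [hE] at this
  exact (Nat.pow_right_injective Fintype.one_lt_card this).symm

theorem adjoin_eq_top_of_pow_eq_one [Fintype F] [Fintype E] (hE : Module.finrank F E = 4)
    (h2 : Even (Fintype.card F)) {β : E} (hβ : β ^ (Fintype.card F ^ 2 + 1) = 1) (h1 : β ≠ 1) :
    Algebra.adjoin F {β} = ⊤ := by
  classical
  rw [← adjoin_simple_toSubalgebra_of_isAlgebraic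
    (Algebra.IsAlgebraic.isAlgebraic _)]
  suffices h : F⟮β⟯ = ⊤ by rw [h]; rfl
  have hd := IntermediateField.finrank_dvd_of_le_right (le_top : F⟮β⟯ ≤ ⊤)
  rw [IntermediateField.finrank_top', hE] at hd
  have key : β ^ Fintype.card F ^ (Module.finrank F (F⟮β⟯)) = β := by
    have := FiniteField.pow_card (⟨β, IntermediateField.mem_adjoin_simple_self F β⟩ : F⟮β⟯)
    rw [Module.card_eq_pow_finrank (K := F)] at this
    exact congrArg Subtype.val this
  apply IntermediateField.eq_of_le_of_finrank_le le_top
  rw [IntermediateField.finrank_top', hE]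
  by_contra hlt
  refine h1 (eq_one_of_pow_eq_self (h2.pow_of_ne_zero two_ne_zero) hβ ?_)
  have : Module.finrank F (F⟮β⟯) = 1 ∨ Module.finrank F (F⟮β⟯) = 2 := by
    generalize Module.finrank F (F⟮β⟯) = d at *
    have : d ≤ 3 := by omega
    interval_cases d <;> omega
  rcases this with h | h <;> rw [h] at key
  · rw [pow_one] at key; rw [sq, pow_mul, key, key]
  · exact key

theorem eq_one_of_add_inv_eq_algebraMap [Fintype F] (h2 : Even (Fintype.card F)) {t : E}
    (ht : t ^ (Fintype.card F ^ 2 + 1) = 1) {s : F} (hs : t + t⁻¹ = algebraMap F E s) : t = 1 := by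
  apply eq_one_of_pow_eq_self (h2.pow_of_ne_zero two_ne_zero) ht
  have h0 : t ≠ 0 := by rintro rfl; simp at ht
  obtain ⟨p, hp⟩ := CharP.exists F
  have : Fact p.Prime := ⟨CharP.char_is_prime F p⟩
  have := charP_of_injective_algebraMap (algebraMap F E).injective p
  obtain ⟨n, -, hn⟩ := FiniteField.card F p
  have h := algebraMap_pow_card E s
  rw [← hs, hn, add_pow_char_pow, ← hn, inv_pow] at h
  have h3 : (t ^ Fintype.card F - t) * (t ^ Fintype.card F - t⁻¹) = 0 := by
    have : t ^ Fintype.card F ≠ 0 := pow_ne_zero _ h0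
    generalize t ^ Fintype.card F = y at *
    field_simp at h ⊢
    linear_combination h
  rw [sq, pow_mul]
  rcases mul_eq_zero.1 h3 with h | h <;> rw [sub_eq_zero] at h
  · rw [h, h]
  · rw [h, inv_pow, h, inv_inv]

theorem splits_X_pow_sub_one_of_dvd [Fintype E] {n : ℕ} (hn : n ∣ Fintype.card E - 1) :
    Splits (X ^ n - 1 : E[X]) := by
  have h : Splits (X ^ Fintype.card E - X : E[X]) := by
    rw [splits_iff_card_roots, FiniteField.roots_X_pow_card_sub_X,
      FiniteField.X_pow_card_sub_X_natDegree_eq E Fintype.one_lt_card]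
    rfl
  refine h.of_dvd (FiniteField.X_pow_card_sub_X_ne_zero E Fintype.one_lt_card) ?_
  have h1 : (X ^ Fintype.card E - X : E[X]) = (X ^ (Fintype.card E - 1) - 1) * X := by
    rw [sub_mul, ← pow_succ, one_mul, Nat.sub_add_cancel Fintype.card_pos]
  rw [h1]
  obtain ⟨k, hk⟩ := hn
  rw [hk, pow_mul]
  exact Dvd.dvd.mul_right (sub_one_dvd_pow_sub_one _ _) _

/-- An endomorphism `T ≠ 1` with `T ^ n = 1` shares an eigenvalue `β ≠ 1` with the field `E`. -/
theorem exists_root_minpoly_dvd {V : Type*} [AddCommGroup V] [Module F V] [FiniteDimensional F V]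
    {n : ℕ} (hs : Splits (X ^ n - 1 : E[X])) (hn0 : (n : F) ≠ 0)
    {T : Module.End F V} (hT : T ^ n = 1) (hT1 : T ≠ 1) :
    ∃ β : E, β ^ n = 1 ∧ β ≠ 1 ∧ minpoly F β ∣ minpoly F T := by
  have hmon : (minpoly F T).Monic := minpoly.monic (Algebra.IsIntegral.isIntegral T)
  have hdvd : minpoly F T ∣ X ^ n - 1 := minpoly.dvd F T (by simp [hT])
  have hsepn : (X ^ n - 1 : F[X]).Separable := by
    simpa using separable_X_pow_sub_C (1 : F) hn0 one_ne_zero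
  have hsep : ((minpoly F T).map (algebraMap F E)).Separable := (hsepn.of_dvd hdvd).map
  have hdvdE : (minpoly F T).map (algebraMap F E) ∣ X ^ n - 1 := by
    simpa using map_dvd (mapRingHom (algebraMap F E)) hdvd
  have hne : (X ^ n - 1 : E[X]) ≠ 0 := by
    simpa using (hsepn.map (f := algebraMap F E)).ne_zero
  have hsp := hs.of_dvd hne hdvdE
  by_contra! hcon
  apply hT1
  have hroot : ∀ β ∈ ((minpoly F T).map (algebraMap F E)).roots, β = 1 := by
    intro β hβ
    rw [mem_roots (hmon.map _).ne_zero] at hβ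
    by_contra h
    refine hcon β ?_ h ?_
    · simpa [sub_eq_zero] using hβ.dvd hdvdE
    · exact minpoly.dvd _ _ (by simpa using hβ)
  have hd : (minpoly F T).map (algebraMap F E) ∣ (X - C 1 : F[X]).map (algebraMap F E) := by
    refine hsp.dvd_of_roots_le_roots (hmon.map _).ne_zero ?_
    rw [Polynomial.map_sub, map_X, map_C, map_one, roots_X_sub_C,
      Multiset.le_iff_subset (nodup_roots hsep)]
    intro β hβ
    simpa using hroot β hβ
  rw [map_dvd_map'] at hd
  have := aeval_eq_zero_of_dvd_aeval_eq_zero hd (minpoly.aeval F T)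
  simpa [sub_eq_zero] using this

/-- Indices move back by one step under the cyclic shift. -/
def cyclicPred (n : ℕ) (i : Fin n) : Fin n := ⟨((i : ℕ) + n - 1) % n, Nat.mod_lt _ i.pos⟩

theorem val_iterate_cyclicPred {k : ℕ} (i : Fin (k + 1)) (j : ℕ) :
    ((cyclicPred (k + 1))^[j] i : ℕ) = (i + j * k) % (k + 1) := by
  induction j with
  | zero => simp [Nat.mod_eq_of_lt i.isLt]
  | succ j ih =>
    rw [Function.iterate_succ_apply']
    simp only [cyclicPred, ih]
    rw [← add_assoc, Nat.add_sub_cancel, Nat.mod_add_mod]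
    ring_nf

theorem iterate_cyclicPred_self {k : ℕ} (i : Fin (k + 1)) : (cyclicPred (k + 1))^[i] i = 0 := by
  ext
  rw [val_iterate_cyclicPred, show (i : ℕ) + i * k = (k + 1) * i by ring]
  simp

theorem iterate_cyclicPred_period {k : ℕ} (i : Fin (k + 1)) :
    (cyclicPred (k + 1))^[k + 1] i = i := by
  ext
  rw [val_iterate_cyclicPred, Nat.add_mul_mod_self_left, Nat.mod_eq_of_lt i.isLt]

/-- The cyclic shift, as an endomorphism of a cyclic code. -/
def IsCyclicCode.shift {F : Type*} [Field F] {n : ℕ} {C : Submodule F (Fin n → F)}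
    (hC : IsCyclicCode C) : Module.End F C :=
  (LinearMap.funLeft F F (cyclicPred n)).restrict hC

theorem IsCyclicCode.shift_pow_apply {F : Type*} [Field F] {n : ℕ} {C : Submodule F (Fin n → F)}
    (hC : IsCyclicCode C) (j : ℕ) (c : C) (i : Fin n) :
    ((hC.shift ^ j) c : Fin n → F) i = (c : Fin n → F) ((cyclicPred n)^[j] i) := by
  induction j generalizing i with
  | zero => rfl
  | succ j ih =>
    rw [pow_succ', Module.End.mul_apply, Function.iterate_succ_apply, ← ih]
    rfl

theorem IsCyclicCode.shift_pow_length {F : Type*} [Field F] {k : ℕ}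
    {C : Submodule F (Fin (k + 1) → F)} (hC : IsCyclicCode C) : hC.shift ^ (k + 1) = 1 := by
  ext c i
  rw [hC.shift_pow_apply, iterate_cyclicPred_period]
  rfl

theorem IsCyclicCode.shift_pow_apply_self {F : Type*} [Field F] {k : ℕ}
    {C : Submodule F (Fin (k + 1) → F)} (hC : IsCyclicCode C) (c : C) (i : Fin (k + 1)) :
    ((hC.shift ^ (i : ℕ)) c : Fin (k + 1) → F) i = (c : Fin (k + 1) → F) 0 := by
  rw [hC.shift_pow_apply, iterate_cyclicPred_self]

theorem IsCyclicCode.shift_ne_one {F : Type*} [Field F] {k : ℕ}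
    {C : Submodule F (Fin (k + 1) → F)} (hC : IsCyclicCode C) (hdim : 1 < Module.finrank F C) :
    hC.shift ≠ 1 := by
  intro h
  have hinj : Function.Injective ((LinearMap.proj 0 : (Fin (k + 1) → F) →ₗ[F] F) ∘ₗ C.subtype) := by
    intro c d hcd
    ext i
    have hc := hC.shift_pow_apply_self c i
    have hd := hC.shift_pow_apply_self d i
    rw [h, one_pow] at hc hd
    exact (hc.trans hcd).trans hd.symm
  have := LinearMap.finrank_le_finrank_of_injective hinj
  rw [Module.finrank_self] at this
  omega

theorem exists_basis_pow [FiniteDimensional F E] {γ : E} (h : Algebra.adjoin F {γ} = ⊤) {d : ℕ}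
    (hd : Module.finrank F E = d) : ∃ b : Module.Basis (Fin d) F E, ∀ i, b i = γ ^ (i : ℕ) := by
  let pb := PowerBasis.ofAdjoinEqTop (Algebra.IsIntegral.isIntegral (R := F) γ) h
  have hpb : pb.dim = d := by rw [← hd, pb.finrank]
  subst hpb
  exact ⟨pb.basis, fun i => by rw [pb.basis_eq_pow, PowerBasis.ofAdjoinEqTop_gen]⟩

theorem natDegree_minpoly_eq_finrank [FiniteDimensional F E] {γ : E}
    (h : Algebra.adjoin F {γ} = ⊤) : (minpoly F γ).natDegree = Module.finrank F E := by
  rw [(PowerBasis.ofAdjoinEqTop (Algebra.IsIntegral.isIntegral (R := F) γ) h).finrank,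
    PowerBasis.ofAdjoinEqTop_dim]

theorem exists_linearEquiv_mul_eq [FiniteDimensional F E] {V : Type*} [AddCommGroup V]
    [Module F V] [FiniteDimensional F V] {T : Module.End F V} {γ : E} (hγ : Algebra.adjoin F {γ} = ⊤)
    (hVE : Module.finrank F V = Module.finrank F E) (hdvd : minpoly F γ ∣ minpoly F T) :
    ∃ e : E ≃ₗ[F] V, ∀ x, e (γ * x) = T (e x) := by
  let pb := PowerBasis.ofAdjoinEqTop (Algebra.IsIntegral.isIntegral (R := F) γ) hγ
  have hT : aeval T (minpoly F pb.gen) = 0 := by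
    have : minpoly F T = minpoly F γ := by
      refine (eq_of_monic_of_dvd_of_natDegree_le (minpoly.monic (Algebra.IsIntegral.isIntegral γ))
        (minpoly.monic (Algebra.IsIntegral.isIntegral T)) hdvd ?_)
      rw [natDegree_minpoly_eq_finrank hγ, ← hVE, ← LinearMap.charpoly_natDegree T]
      exact natDegree_le_of_dvd (LinearMap.minpoly_dvd_charpoly T) T.charpoly_monic.ne_zero
    rw [PowerBasis.ofAdjoinEqTop_gen, ← this, minpoly.aeval]
  let ρ : E →ₐ[F] Module.End F V := pb.lift T hT
  have hρ : ρ γ = T := pb.lift_gen T hT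
  have : Nontrivial V := Module.nontrivial_of_finrank_pos (R := F) (hVE ▸ Module.finrank_pos)
  obtain ⟨v, hv⟩ := exists_ne (0 : V)
  let f : E →ₗ[F] V := (LinearMap.applyₗ v) ∘ₗ ρ.toLinearMap
  have hf : Function.Injective f := by
    rw [injective_iff_map_eq_zero]
    intro x hx
    by_contra hx0
    apply hv
    have h1 : ρ x⁻¹ (ρ x v) = v := by
      rw [← Module.End.mul_apply, ← map_mul, inv_mul_cancel₀ hx0, map_one, Module.End.one_apply]
    rw [← h1, show ρ x v = 0 from hx, map_zero]
  refine ⟨LinearEquiv.ofInjectiveOfFinrankEq f hf hVE.symm, fun x => ?_⟩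
  change ρ (γ * x) v = T (ρ x v)
  rw [map_mul, hρ, Module.End.mul_apply]

theorem IsCyclicCode.exists_eq_apply {k : ℕ} {C : Submodule F (Fin (k + 1) → F)}
    (hC : IsCyclicCode C) {γ : E} (hγ0 : γ ≠ 0) (e : E ≃ₗ[F] C)
    (he : ∀ x, e (γ * x) = hC.shift (e x)) :
    ∃ l : E →ₗ[F] F, ∀ c ∈ C, ∃ x, ∀ i, c i = l (γ⁻¹ ^ (i : ℕ) * x) := by
  refine ⟨LinearMap.proj 0 ∘ₗ C.subtype ∘ₗ e.toLinearMap, fun c hc => ⟨e.symm ⟨c, hc⟩, fun i => ?_⟩⟩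
  have hpow : ∀ (j : ℕ) (x : E), e (γ ^ j * x) = (hC.shift ^ j) (e x) := by
    intro j
    induction j with
    | zero => simp
    | succ j ih =>
      intro x
      rw [pow_succ', mul_assoc, he, ih, pow_succ', Module.End.mul_apply]
  have h := hC.shift_pow_apply_self (e (γ⁻¹ ^ (i : ℕ) * e.symm ⟨c, hc⟩)) i
  rw [← hpow, ← mul_assoc, ← mul_pow, mul_inv_cancel₀ hγ0, one_pow, one_mul,
    e.apply_symm_apply] at h
  exact h

theorem orderOf_eq_of_hammingNorm_eq {q : ℕ} (h2 : Even q) [DecidableEq F] {β x : E} {l : E →ₗ[F] F}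
    (hβ : β ^ (q ^ 2 + 1) = 1)
    (h : hammingNorm (fun i : Fin (q ^ 2 + 1) => l (β ^ (i : ℕ) * x)) = q ^ 2 - q) :
    orderOf β = q ^ 2 + 1 := by
  obtain ⟨r, hr⟩ := orderOf_dvd_of_pow_eq_one hβ
  rw [hammingNorm_eq_count (fun i : ℕ => l (β ^ i * x)), hr, Nat.count_mul_of_periodic] at h
  · have hq : q ≤ q ^ 2 := Nat.le_self_pow two_ne_zero q
    have d1 : r ∣ q ^ 2 - q := ⟨_, h.symm⟩
    have d2 : r ∣ q ^ 2 + 1 := ⟨orderOf β, by rw [hr, mul_comm]⟩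
    have d3 : r ∣ q + 1 := by
      have := Nat.dvd_sub d2 d1
      rwa [show q ^ 2 + 1 - (q ^ 2 - q) = q + 1 by omega] at this
    have d4 : r ∣ 2 := by
      have h1 : (r : ℤ) ∣ q ^ 2 + 1 := by exact_mod_cast d2
      have h3 : (r : ℤ) ∣ q + 1 := by exact_mod_cast d3
      have := dvd_sub h1 (h3.mul_right (q - 1))
      rw [show (q : ℤ) ^ 2 + 1 - (q + 1) * (q - 1) = 2 by ring] at this
      exact_mod_cast this
    rcases (Nat.dvd_prime Nat.prime_two).1 d4 with rfl | rfl
    · rw [hr, mul_one]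
    · obtain ⟨a, rfl⟩ := h2
      obtain ⟨b, hb⟩ := d3
      omega
  · intro i
    rw [pow_add, pow_orderOf_eq_one, mul_one]

theorem code_eq_span {n d : ℕ} {C : Submodule F (Fin n → F)} (b : Module.Basis (Fin d) F E)
    (hdim : Module.finrank F C = d) {u : Fin n → E} {l : E →ₗ[F] F}
    (h : ∀ c ∈ C, ∃ x, ∀ i, c i = l (u i * x)) :
    C = Submodule.span F (Set.range fun j i => b.repr (u i) j) := by
  refine Submodule.eq_of_le_of_finrank_le ?_ ?_
  · intro c hc
    obtain ⟨x, hx⟩ := h c hc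
    have : c = ∑ j, l (b j * x) • fun i => b.repr (u i) j := by
      ext i
      rw [hx, Finset.sum_apply]
      conv_lhs => rw [← b.sum_repr (u i), Finset.sum_mul, map_sum]
      refine Finset.sum_congr rfl fun j _ => ?_
      rw [smul_mul_assoc, map_smul, Pi.smul_apply, smul_eq_mul, smul_eq_mul, mul_comm]
    rw [this]
    exact Submodule.sum_mem _ fun j _ => Submodule.smul_mem _ _ (Submodule.subset_span ⟨j, rfl⟩)
  · rw [hdim]
    exact (finrank_range_le_card _).trans (by simp)

theorem pow_card_sq_algebraMap [Fintype F] (a : F) :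
    algebraMap F E a ^ (Fintype.card F ^ 2) = algebraMap F E a := by
  rw [sq, pow_mul, algebraMap_pow_card, algebraMap_pow_card]

theorem smul_pow_card_sq_add_one [Fintype F] (a : F) (u : E) :
    (a • u) ^ (Fintype.card F ^ 2 + 1) = algebraMap F E (a * a) * u ^ (Fintype.card F ^ 2 + 1) := by
  rw [Algebra.smul_def, mul_pow, pow_succ (algebraMap F E a), pow_card_sq_algebraMap, map_mul]

theorem eq_of_eq_smul [Fintype F] (h2 : Even (Fintype.card F)) {u v : E}
    (hu : u ^ (Fintype.card F ^ 2 + 1) = 1) (hv : v ^ (Fintype.card F ^ 2 + 1) = 1) {a : F}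
    (h : u = a • v) : u = v := by
  have h1 : algebraMap F E a = 1 := by
    refine eq_one_of_pow_eq_self (h2.pow_of_ne_zero two_ne_zero) ?_ (pow_card_sq_algebraMap a)
    rwa [h, Algebra.smul_def, mul_pow, hv, mul_one] at hu
  rw [h, Algebra.smul_def, h1, one_mul]

theorem add_pow_card_sq [Fintype F] (u v : E) :
    (u + v) ^ (Fintype.card F ^ 2) = u ^ (Fintype.card F ^ 2) + v ^ (Fintype.card F ^ 2) := by
  obtain ⟨p, hp⟩ := CharP.exists F
  have : Fact p.Prime := ⟨CharP.char_is_prime F p⟩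
  have := charP_of_injective_algebraMap (algebraMap F E).injective p
  obtain ⟨n, -, hn⟩ := FiniteField.card F p
  rw [hn, ← pow_mul, add_pow_char_pow]

theorem eq_zero_or_eq_zero_of_smul_add_smul [Fintype F] (h2 : Even (Fintype.card F)) {u v : E}
    (hu : u ^ (Fintype.card F ^ 2 + 1) = 1) (hv : v ^ (Fintype.card F ^ 2 + 1) = 1) (huv : u ≠ v)
    {a b : F} (h : (a • u + b • v) ^ (Fintype.card F ^ 2 + 1) = 1) : a = 0 ∨ b = 0 := by
  by_contra! hab
  obtain ⟨ha, hb⟩ := hab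
  have hu0 : u ≠ 0 := by rintro rfl; simp at hu
  have hv0 : v ≠ 0 := by rintro rfl; simp at hv
  apply huv
  rw [← div_eq_one_iff_eq hv0]
  refine eq_one_of_add_inv_eq_algebraMap h2 (s := (1 - a ^ 2 - b ^ 2) / (a * b))
    (by rw [div_pow, hu, hv, div_one]) ?_
  rw [pow_succ, add_pow_card_sq] at h
  simp only [Algebra.smul_def, mul_pow, pow_card_sq_algebraMap] at h
  rw [eq_inv_of_mul_eq_one_left ((pow_succ u _).symm.trans hu),
    eq_inv_of_mul_eq_one_left ((pow_succ v _).symm.trans hv)] at h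
  have ha' : algebraMap F E a ≠ 0 := by simpa
  have hb' : algebraMap F E b ≠ 0 := by simpa
  simp only [map_div₀, map_sub, map_mul, map_pow, map_one]
  field_simp at h ⊢
  linear_combination h

theorem coeff_eq_zero_of_distinct [Fintype F] (h2 : Even (Fintype.card F)) {u v w : E}
    (hu : u ^ (Fintype.card F ^ 2 + 1) = 1) (hv : v ^ (Fintype.card F ^ 2 + 1) = 1)
    (hw : w ^ (Fintype.card F ^ 2 + 1) = 1) (huv : u ≠ v) (huw : u ≠ w) (hvw : v ≠ w)
    {a b c : F} (h : a • u + b • v + c • w = 0) : c = 0 := by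
  by_contra hc
  have hw' : w = (-a / c) • u + (-b / c) • v := by
    rw [← smul_right_inj hc, smul_add, smul_smul, smul_smul, mul_div_cancel₀ _ hc,
      mul_div_cancel₀ _ hc, neg_smul, neg_smul]
    linear_combination h
  rcases eq_zero_or_eq_zero_of_smul_add_smul h2 hu hv huv (hw' ▸ hw) with h0 | h0
  · rw [h0, zero_smul, zero_add] at hw'
    exact hvw (eq_of_eq_smul h2 hw hv hw').symm
  · rw [h0, zero_smul, add_zero] at hw'
    exact huw (eq_of_eq_smul h2 hw hu hw').symm

theorem quadric_eq [Fintype F] (h2 : Even (Fintype.card F)) (h20 : (2 : E) = 0) :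
    {v : E | v ^ (Fintype.card F ^ 2 + 1) + (v ^ (Fintype.card F ^ 2 + 1)) ^ Fintype.card F = 0} =
      {v : E | ∃ (l : F) (u : E), u ^ (Fintype.card F ^ 2 + 1) = 1 ∧ v = l • u} := by
  ext v
  simp only [Set.mem_ofPred_eq]
  constructor
  · intro h
    by_cases hv : v = 0
    · exact ⟨0, 1, one_pow _, by rw [hv, zero_smul]⟩
    obtain ⟨a, ha⟩ := exists_algebraMap_eq_of_pow_card (F := F) (x := v ^ (Fintype.card F ^ 2 + 1))
      (by linear_combination h - v ^ (Fintype.card F ^ 2 + 1) * h20)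
    obtain ⟨k, hk⟩ := h2
    have hl : a ^ k * a ^ k = a := by rw [← pow_add, ← hk, FiniteField.pow_card]
    have ha0 : a ≠ 0 := by
      rintro rfl
      rw [map_zero] at ha
      exact pow_ne_zero _ hv ha.symm
    have hl0 : a ^ k ≠ 0 := pow_ne_zero _ ha0
    refine ⟨a ^ k, (a ^ k)⁻¹ • v, ?_, (smul_inv_smul₀ hl0 v).symm⟩
    rw [smul_pow_card_sq_add_one, ← ha, ← map_mul, ← mul_inv, hl, inv_mul_cancel₀ ha0, map_one]
  · rintro ⟨l, u, hu, rfl⟩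
    rw [smul_pow_card_sq_add_one, hu, mul_one, algebraMap_pow_card]
    linear_combination algebraMap F E (l * l) * h20

theorem range_pow_eq {n : ℕ} {β : E} (h : orderOf β = n) (hn : 0 < n) :
    Set.range (fun i : Fin n => β ^ (i : ℕ)) = {u : E | u ^ n = 1} := by
  have : NeZero n := ⟨hn.ne'⟩
  ext u
  simp only [Set.mem_range, Set.mem_ofPred_eq]
  constructor
  · rintro ⟨i, rfl⟩
    rw [← pow_mul, mul_comm, pow_mul, orderOf_dvd_iff_pow_eq_one.1 h.dvd, one_pow]
  · intro hu
    obtain ⟨i, hi, rfl⟩ := (h ▸ IsPrimitiveRoot.orderOf β).eq_pow_of_pow_eq_one hu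
    exact ⟨⟨i, hi⟩, rfl⟩

theorem pow_injective_of_orderOf {n : ℕ} {β : E} (h : orderOf β = n) :
    Function.Injective (fun i : Fin n => β ^ (i : ℕ)) := by
  intro i j hij
  exact Fin.ext ((h ▸ IsPrimitiveRoot.orderOf β).pow_inj i.isLt j.isLt hij)

end

/-- **Theorem (cyclic `[q²+1, 4, q²−q]` codes are elliptic-quadric ovoid codes).**
Let `q = 2^m`, `F = 𝔽_q ⊆ 𝔽_{q²} ⊆ E = 𝔽_{q⁴}`, and let `C` be a cyclic code over `F`
with parameters `[q²+1, 4, q²−q]`.  Then there are a generator `γ` of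
`O = {u ∈ E : u^{q²+1} = 1}` (so `γ` has order `q²+1`) and an `F`-basis `{1, ξ, ζ, η}`
of `E` such that, writing `γ^{−i} = x_i + y_i ξ + z_i ζ + w_i η`, the code `C` is the
row space of the `4 × (q²+1)` matrix whose `i`-th column is `(x_i, y_i, z_i, w_i)`;
the columns, viewed as points of `PG(3,q) = P(E)`, are pairwise distinct and form the
elliptic quadric determined by `O`, i.e. the zero set of the quadratic form
`Q(x) = Tr_{𝔽_{q²}/F}(x^{q²+1}) = x^{q²+1} + (x^{q²+1})^q`, which is an ovoid of
`PG(3,q)` (`q²+1` points, no three collinear). -/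
theorem cyclic_code_gives_elliptic_quadric_ovoid
    (m q : ℕ) (hm : 1 ≤ m) (hq : q = 2 ^ m)
    (F E : Type*) [Field F] [Fintype F] [DecidableEq F] [Field E] [Fintype E] [Algebra F E]
    (hF : Fintype.card F = q) (hE : Fintype.card E = q ^ 4)
    (C : Submodule F (Fin (q ^ 2 + 1) → F))
    (hcyc : IsCyclicCode C)
    (hdim : Module.finrank F ↥C = 4)
    (hdist : (∀ c ∈ C, c ≠ 0 → q ^ 2 - q ≤ hammingNorm c) ∧
      ∃ c ∈ C, c ≠ 0 ∧ hammingNorm c = q ^ 2 - q) :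
    ∃ (γ ξ ζ η : E) (xs ys zs ws : Fin (q ^ 2 + 1) → F),
      orderOf γ = q ^ 2 + 1 ∧
      (∀ v : E, ∃! a : Fin 4 → F,
        v = algebraMap F E (a 0) + a 1 • ξ + a 2 • ζ + a 3 • η) ∧
      (∀ i : Fin (q ^ 2 + 1),
        algebraMap F E (xs i) + ys i • ξ + zs i • ζ + ws i • η = γ⁻¹ ^ (i : ℕ)) ∧
      C = Submodule.span F {xs, ys, zs, ws} ∧
      Function.Injective (fun i : Fin (q ^ 2 + 1) => γ⁻¹ ^ (i : ℕ)) ∧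
      Set.range (fun i : Fin (q ^ 2 + 1) => γ⁻¹ ^ (i : ℕ)) = {u : E | u ^ (q ^ 2 + 1) = 1} ∧
      {v : E | v ^ (q ^ 2 + 1) + (v ^ (q ^ 2 + 1)) ^ q = 0} =
        {v : E | ∃ (l : F) (u : E), u ^ (q ^ 2 + 1) = 1 ∧ v = l • u} ∧
      Set.ncard {u : E | u ^ (q ^ 2 + 1) = 1} = q ^ 2 + 1 ∧
      (∀ u v w : E, u ^ (q ^ 2 + 1) = 1 → v ^ (q ^ 2 + 1) = 1 → w ^ (q ^ 2 + 1) = 1 →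
        u ≠ v → u ≠ w → v ≠ w →
        ∀ a b c : F, a • u + b • v + c • w = 0 → a = 0 ∧ b = 0 ∧ c = 0) := by
  subst hF
  have h2 : Even (Fintype.card F) := by
    rw [hq]
    exact even_two.pow_of_ne_zero (by omega)
  have h20 : (2 : F) = 0 := by
    have h := Nat.cast_card_eq_zero F
    rw [hq, Nat.cast_pow, Nat.cast_two] at h
    exact pow_eq_zero_iff (by omega) |>.1 h
  have h20E : (2 : E) = 0 := by rw [← map_ofNat (algebraMap F E) 2, h20, map_zero]
  have hfr : Module.finrank F E = 4 := finrank_eq_four_of_card_eq_pow hE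
  have hsplit : Splits (X ^ (Fintype.card F ^ 2 + 1) - 1 : E[X]) := by
    refine splits_X_pow_sub_one_of_dvd ⟨Fintype.card F ^ 2 - 1, ?_⟩
    rw [hE, ← Nat.sq_sub_sq, ← pow_mul, one_pow]
  obtain ⟨γ, hγ, hγ1, hdvd⟩ := exists_root_minpoly_dvd hsplit (by simp) hcyc.shift_pow_length
    (hcyc.shift_ne_one (by omega))
  have hγ0 : γ ≠ 0 := by rintro rfl; simp at hγ
  have htop := adjoin_eq_top_of_pow_eq_one hfr h2 hγ hγ1
  obtain ⟨e, he⟩ := exists_linearEquiv_mul_eq htop (hdim.trans hfr.symm) hdvd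
  obtain ⟨l, hl⟩ := hcyc.exists_eq_apply hγ0 e he
  obtain ⟨b, hb⟩ := exists_basis_pow htop hfr
  have hord : orderOf γ⁻¹ = Fintype.card F ^ 2 + 1 := by
    obtain ⟨-, c, hc, -, hw⟩ := hdist
    obtain ⟨x, hx⟩ := hl c hc
    rw [funext hx] at hw
    exact orderOf_eq_of_hammingNorm_eq h2 (by rw [inv_pow, hγ, inv_one]) hw
  have hsum (a : Fin 4 → F) : algebraMap F E (a 0) + a 1 • b 1 + a 2 • b 2 + a 3 • b 3 =
      ∑ j, a j • b j := by
    rw [Fin.sum_univ_four, show b 0 = 1 by rw [hb]; exact pow_zero γ, Algebra.algebraMap_eq_smul_one]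
  have hinj := pow_injective_of_orderOf hord
  have hrange := range_pow_eq hord (Nat.succ_pos _)
  refine ⟨γ, b 1, b 2, b 3, fun i => b.repr (γ⁻¹ ^ (i : ℕ)) 0, fun i => b.repr (γ⁻¹ ^ (i : ℕ)) 1,
    fun i => b.repr (γ⁻¹ ^ (i : ℕ)) 2, fun i => b.repr (γ⁻¹ ^ (i : ℕ)) 3, ?_, ?_, ?_, ?_, hinj,
    hrange, quadric_eq h2 h20E, ?_, ?_⟩
  · have h := (IsPrimitiveRoot.orderOf γ⁻¹).inv.eq_orderOf
    rw [inv_inv, hord] at h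
    exact h.symm
  · intro v
    simp only [hsum]
    refine ⟨b.repr v, (b.sum_repr v).symm, fun a ha => ?_⟩
    rw [ha, b.repr_sum_self]
  · intro i
    rw [hsum fun j => b.repr (γ⁻¹ ^ (i : ℕ)) j, b.sum_repr]
  · rw [code_eq_span b hdim hl]
    congr 1
    ext c
    simp [Fin.exists_fin_succ, eq_comm]
  · rw [← hrange, ← Set.image_univ, Set.ncard_image_of_injective _ hinj, Set.ncard_univ,
      Nat.card_fin]
  · intro u v w hu hv hw huv huw hvw a b c h
    exact ⟨coeff_eq_zero_of_distinct h2 hv hw hu hvw huv.symm huw.symm (by rw [← h]; abel),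
      coeff_eq_zero_of_distinct h2 hw hu hv huw.symm hvw.symm huv (by rw [← h]; abel),
      coeff_eq_zero_of_distinct h2 hu hv hw huv huw hvw h⟩
end
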